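/- arXiv:2407.15744 — 6 statements merged into one kernel-verified Lean document; each statement's English description precedes it below -/
import Mathlib

section
/- (Trek rule) Let G be a directed mixed graph on V = {1, …, d}, and let β, Λ ∈ ℝ^{d×d} be compatible with G, with Λ symmetric positive semi-definite and β having spectral radius strictly less than 1. Set Σ = (I − β)^{-T} Λ (I − β)^{-1}. Then for all j, k: Σ_{jk} = Σ_{q=1}^{∞} t_q(j,k), where t_q(j,k) is the (finite) sum of the weights of all treks from j to k in G of length q, and the series converges absolutely. -/
/-! ### Walks on directed mixed graphs -/

/-- How an edge is traversed by a walk. -/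
inductive EKind : Type
  | fwd   -- a directed edge traversed forwards:  `a → b`
  | bwd   -- a directed edge traversed backwards: `a ← b` (the edge is `b → a`)
  | bidir -- a bidirected edge: `a ↔ b`
  deriving DecidableEq

/-- A directed mixed graph on vertex type `V` (directed edges `dir`, bidirected
edges `bi`; loops are allowed). -/
structure MixedGraph (V : Type*) where
  dir : V → V → Prop
  bi : V → V → Prop

/-- A candidate walk: a starting vertex together with a list of steps; each step
records how the next edge is traversed and the next vertex reached. -/
structure MWalk (V : Type*) where
  head : V
  tail : List (EKind × V)

namespace MWalk

variable {V : Type*}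

/-- The last vertex of a walk. -/
def last (w : MWalk V) : V := (w.tail.map Prod.snd).getLastD w.head

/-- The list of vertex occurrences of a walk. -/
def verts (w : MWalk V) : List V := w.head :: w.tail.map Prod.snd

/-- The length (number of edge-traversals) of a walk. -/
def length (w : MWalk V) : ℕ := w.tail.length

/-- The non-endpoint (interior) vertex occurrences of a walk. -/
def interior (w : MWalk V) : List V := (w.tail.map Prod.snd).dropLast

/-- Does this kind of traversal have an arrowhead at its end vertex? -/
def arrowAtEnd : EKind → Bool
  | .fwd => true
  | .bwd => false
  | .bidir => true

/-- Does this kind of traversal have an arrowhead at its start vertex? -/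
def arrowAtStart : EKind → Bool
  | .fwd => false
  | .bwd => true
  | .bidir => true

/-- The interior vertex occurrence reached by step `i` (present when
`i + 1 < w.tail.length`) is a collider. -/
def ColliderAt (w : MWalk V) (i : ℕ) : Prop :=
  ∃ s t : EKind × V, w.tail[i]? = some s ∧ w.tail[i + 1]? = some t ∧
    arrowAtEnd s.1 = true ∧ arrowAtStart t.1 = true

/-- The walk contains no collider. -/
def NoCollider (w : MWalk V) : Prop := ∀ i, ¬ w.ColliderAt i

/-- Validity in `G` of a list of steps starting at a given vertex. -/
def Valid (G : MixedGraph V) : V → List (EKind × V) → Prop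
  | _, [] => True
  | a, s :: rest =>
      (match s.1 with
        | EKind.fwd => G.dir a s.2
        | EKind.bwd => G.dir s.2 a
        | EKind.bidir => G.bi a s.2) ∧ Valid G s.2 rest

/-- `w` is a walk (with at least one edge) in `G`. -/
def IsWalk (G : MixedGraph V) (w : MWalk V) : Prop := w.tail ≠ [] ∧ Valid G w.head w.tail

/-- `w` is a walk in `G` from `j` to `k`. -/
def IsWalkFrom (G : MixedGraph V) (w : MWalk V) (j k : V) : Prop :=
  IsWalk G w ∧ w.head = j ∧ w.last = k

/-- A right-directed walk: all directed edges traversed forwards. -/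
def IsRightDirected (w : MWalk V) : Prop := ∀ s ∈ w.tail, s.1 = EKind.fwd

/-- A left-directed walk: all directed edges traversed backwards. -/
def IsLeftDirected (w : MWalk V) : Prop := ∀ s ∈ w.tail, s.1 = EKind.bwd

/-- A walk using only directed edges (traversed in either direction). -/
def DirectedOnly (w : MWalk V) : Prop := ∀ s ∈ w.tail, s.1 ≠ EKind.bidir

/-- A trek: a (possibly empty) left leg of directed edges traversed backwards,
then exactly one bidirected edge, then a (possibly empty) right leg of directed
edges traversed forwards. -/
def IsTrek (w : MWalk V) : Prop :=
  ∃ (l : List (EKind × V)) (b : EKind × V) (r : List (EKind × V)),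
    w.tail = l ++ b :: r ∧ (∀ s ∈ l, s.1 = EKind.bwd) ∧ b.1 = EKind.bidir ∧
      (∀ s ∈ r, s.1 = EKind.fwd)

/-- A d-connected walk: directed edges traversed backwards followed by directed
edges traversed forwards, at least one edge in total. -/
def IsDConnWalk (w : MWalk V) : Prop :=
  w.tail ≠ [] ∧ ∃ l r : List (EKind × V), w.tail = l ++ r ∧
    (∀ s ∈ l, s.1 = EKind.bwd) ∧ (∀ s ∈ r, s.1 = EKind.fwd)

/-- An arc (m-connected walk): a trek or a d-connected walk. -/
def IsArc (w : MWalk V) : Prop := IsTrek w ∨ IsDConnWalk w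

/-- A path: a walk visiting no vertex more than once. -/
def IsPath (w : MWalk V) : Prop := w.verts.Nodup

/-- The number of bidirected edges traversed by the walk. -/
def bidirCount (w : MWalk V) : ℕ := w.tail.countP (fun s => decide (s.1 = EKind.bidir))

/-- `w` is blocked by `L`: some collider on it lies outside `L`, or some
non-collider non-endpoint on it lies in `L`. -/
def Blocked (w : MWalk V) (L : Set V) : Prop :=
  ∃ (i : ℕ) (v : V), i + 1 < w.tail.length ∧ (w.tail[i]?).map Prod.snd = some v ∧
    ((w.ColliderAt i ∧ v ∉ L) ∨ (¬ w.ColliderAt i ∧ v ∈ L))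

/-- A collider-connected walk: all non-endpoints are colliders. -/
def IsColliderConnected (w : MWalk V) : Prop := ∀ i, i + 1 < w.tail.length → w.ColliderAt i

/-- The weight of a list of steps starting from a given vertex: `β l m` for a
traversal (in either direction) of the directed edge `l → m` and `Λ l m` for a
traversal of the bidirected edge `l ↔ m`. -/
def weightFrom (β Λ : V → V → ℝ) : V → List (EKind × V) → ℝ
  | _, [] => 1
  | a, s :: rest =>
      (match s.1 with
        | EKind.fwd => β a s.2
        | EKind.bwd => β s.2 a
        | EKind.bidir => Λ a s.2) * weightFrom β Λ s.2 rest

/-- The weight of a walk. -/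
def weight (β Λ : V → V → ℝ) (w : MWalk V) : ℝ := weightFrom β Λ w.head w.tail

end MWalk

namespace MixedGraph

variable {V : Type*}

/-- The bidirected edge relation is symmetric. -/
def BiSymm (G : MixedGraph V) : Prop := ∀ j k, G.bi j k → G.bi k j

/-- Canonical: every vertex carries a bidirected loop. -/
def Canonical (G : MixedGraph V) : Prop := ∀ v, G.bi v v

/-- Canonically directed: the bidirected edges are exactly the loops. -/
def CanonicallyDirected (G : MixedGraph V) : Prop := ∀ j k, G.bi j k ↔ j = k

/-- There is a right-directed walk from `j` to `k` in `G`. -/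
def RDConn (G : MixedGraph V) (j k : V) : Prop :=
  ∃ w : MWalk V, MWalk.IsWalkFrom G w j k ∧ w.IsRightDirected

/-- Acyclicity: no right-directed walk from a vertex to itself. -/
def Acyclic (G : MixedGraph V) : Prop := ∀ v, ¬ G.RDConn v v

/-- Remove all bidirected loops. -/
def trim (G : MixedGraph V) : MixedGraph V where
  dir := G.dir
  bi j k := G.bi j k ∧ j ≠ k

/-- m-connection given `L`: some walk from `j` to `k` is not blocked by `L`. -/
def MConn (G : MixedGraph V) (j k : V) (L : Set V) : Prop :=
  ∃ w : MWalk V, MWalk.IsWalkFrom G w j k ∧ ¬ w.Blocked L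

/-- d-connection given `L`: some walk from `j` to `k` using only directed edges
is not blocked by `L`. -/
def DConn (G : MixedGraph V) (j k : V) (L : Set V) : Prop :=
  ∃ w : MWalk V, MWalk.IsWalkFrom G w j k ∧ w.DirectedOnly ∧ ¬ w.Blocked L

/-- `w` is ancestrally blocked by `L`: it contains a collider `v ∉ L` with no
right-directed walk from `v` to a member of `L`, or a non-collider non-endpoint
in `L`. -/
def AncBlocked (G : MixedGraph V) (w : MWalk V) (L : Set V) : Prop :=
  ∃ (i : ℕ) (v : V), i + 1 < w.tail.length ∧ (w.tail[i]?).map Prod.snd = some v ∧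
    ((w.ColliderAt i ∧ v ∉ L ∧ ¬ ∃ l ∈ L, G.RDConn v l) ∨ (¬ w.ColliderAt i ∧ v ∈ L))

/-- The marginal graph (latent projection) of `G` on `T`. -/
def marg (G : MixedGraph V) (T : Set V) : MixedGraph V where
  dir j k := j ∈ T ∧ k ∈ T ∧ ∃ w : MWalk V, MWalk.IsWalkFrom G w j k ∧
      w.IsRightDirected ∧ ∀ v ∈ w.interior, v ∉ T
  bi j k := j ∈ T ∧ k ∈ T ∧ ∃ w : MWalk V, MWalk.IsWalkFrom G w j k ∧
      w.IsTrek ∧ ∀ v ∈ w.interior, v ∉ T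

/-- t-connection given `L`: a concatenation of treks, each not blocked by `L`,
with consecutive treks meeting at vertices belonging to `L`. -/
inductive TConn (G : MixedGraph V) (L : Set V) : V → V → Prop
  | single {j k : V} (w : MWalk V) (hw : MWalk.IsWalkFrom G w j k) (ht : w.IsTrek)
      (hb : ¬ w.Blocked L) : TConn G L j k
  | cons {j m k : V} (w : MWalk V) (hw : MWalk.IsWalkFrom G w j m) (ht : w.IsTrek)
      (hb : ¬ w.Blocked L) (hm : m ∈ L) (h : TConn G L m k) : TConn G L j k

end MixedGraph

namespace TrekAux

open Finset

variable {d : ℕ}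

/-- Enumeration of right legs. -/
def R : ℕ → Fin d → Fin d → Finset (List (EKind × Fin d))
  | 0, a, k => if a = k then {[]} else ∅
  | n + 1, _, k => univ.biUnion fun m => (R n m k).image (List.cons (EKind.fwd, m))

/-- Enumeration of trek tails. -/
def T : ℕ → Fin d → Fin d → Finset (List (EKind × Fin d))
  | 0, _, _ => ∅
  | n + 1, _, k => univ.biUnion fun m =>
      (T n m k).image (List.cons (EKind.bwd, m)) ∪ (R n m k).image (List.cons (EKind.bidir, m))

theorem mem_R (n : ℕ) (a k : Fin d) (t : List (EKind × Fin d)) :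
    t ∈ R n a k ↔ (∀ s ∈ t, s.1 = EKind.fwd) ∧ t.length = n ∧
      (t.map Prod.snd).getLastD a = k := by
  induction n generalizing a t with
  | zero =>
    cases t with
    | nil => by_cases h : a = k <;> simp [R, h]
    | cons s t => by_cases h : a = k <;> simp [R, h]
  | succ n ih =>
    cases t with
    | nil => simp [R]
    | cons s t =>
      obtain ⟨e, v⟩ := s
      simp only [R, mem_biUnion, mem_univ, true_and, mem_image, List.cons.injEq, Prod.mk.injEq,
        List.forall_mem_cons, List.length_cons, List.map_cons, List.getLastD_cons]
      constructor
      · rintro ⟨m, t', ht', ⟨rfl, rfl⟩, rfl⟩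
        obtain ⟨h1, h2, h3⟩ := (ih _ _).1 ht'
        exact ⟨⟨rfl, h1⟩, by omega, h3⟩
      · rintro ⟨⟨h0, h1⟩, h2, h3⟩
        exact ⟨v, t, (ih _ _).2 ⟨h1, by omega, h3⟩, ⟨h0.symm, rfl⟩, rfl⟩

theorem mem_T (n : ℕ) (a k : Fin d) (t : List (EKind × Fin d)) :
    t ∈ T n a k ↔ (MWalk.mk a t).IsTrek ∧ t.length = n ∧
      (t.map Prod.snd).getLastD a = k := by
  induction n generalizing a t with
  | zero =>
    cases t with
    | nil => simp [T, MWalk.IsTrek]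
    | cons s t => simp [T]
  | succ n ih =>
    cases t with
    | nil => simp [T]
    | cons s t =>
      obtain ⟨e, v⟩ := s
      simp only [T, mem_biUnion, mem_univ, true_and, mem_image, mem_union, List.cons.injEq,
        Prod.mk.injEq, List.length_cons, List.map_cons, List.getLastD_cons]
      constructor
      · rintro ⟨m, ⟨t', ht', ⟨rfl, rfl⟩, rfl⟩ | ⟨t', ht', ⟨rfl, rfl⟩, rfl⟩⟩
        · obtain ⟨⟨l, b, r, h, hl, hb, hr⟩, h2, h3⟩ := (ih _ _).1 ht'
          refine ⟨⟨(EKind.bwd, m) :: l, b, r, ?_, ?_, hb, hr⟩, by omega, h3⟩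
          · simpa using h
          · intro s hs
            rcases List.mem_cons.1 hs with rfl | hs
            · rfl
            · exact hl s hs
        · obtain ⟨h1, h2, h3⟩ := (mem_R _ _ _ _).1 ht'
          exact ⟨⟨[], (EKind.bidir, m), t', rfl, by simp, rfl, h1⟩, by omega, h3⟩
      · rintro ⟨⟨l, b, r, h, hl, hb, hr⟩, h2, h3⟩
        refine ⟨v, ?_⟩
        cases l with
        | nil =>
          simp only [List.nil_append, List.cons.injEq] at h
          obtain ⟨rfl, rfl⟩ := h
          right
          exact ⟨t, (mem_R _ _ _ _).2 ⟨hr, by omega, h3⟩, ⟨hb.symm, rfl⟩, rfl⟩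
        | cons s l =>
          simp only [List.cons_append, List.cons.injEq] at h
          obtain ⟨rfl, rfl⟩ := h
          left
          have h0 := hl _ List.mem_cons_self
          exact ⟨_, (ih _ _).2 ⟨⟨l, b, r, rfl, fun s hs => hl s (List.mem_cons_of_mem _ hs), hb, hr⟩,
            by omega, h3⟩, ⟨h0.symm, rfl⟩, rfl⟩

theorem sum_R (β Λ : Matrix (Fin d) (Fin d) ℝ) (n : ℕ) (a k : Fin d) :
    ∑ t ∈ R n a k, MWalk.weightFrom (fun a b => β a b) (fun a b => Λ a b) a t = (β ^ n) a k := by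
  induction n generalizing a with
  | zero =>
    by_cases h : a = k
    · subst h; simp [R, MWalk.weightFrom]
    · simp [R, h, Matrix.one_apply]
  | succ n ih =>
    rw [R, sum_biUnion, pow_succ', Matrix.mul_apply]
    · refine sum_congr rfl fun m _ => ?_
      rw [sum_image (by intro x _ y _ h; simpa using h), ← ih, mul_sum]
      rfl
    · intro x _ y _ hxy
      rw [Function.onFun, Finset.disjoint_left]
      intro t h1 h2
      simp only [mem_image] at h1 h2
      obtain ⟨u, _, rfl⟩ := h1
      obtain ⟨v, _, h⟩ := h2
      simp only [List.cons.injEq, Prod.mk.injEq] at h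
      exact hxy h.1.2.symm

theorem sum_T_succ (β Λ : Matrix (Fin d) (Fin d) ℝ) (n : ℕ) (a k : Fin d) :
    ∑ t ∈ T (n + 1) a k, MWalk.weightFrom (fun a b => β a b) (fun a b => Λ a b) a t =
      ∑ m, β m a * (∑ t ∈ T n m k, MWalk.weightFrom (fun a b => β a b) (fun a b => Λ a b) m t)
      + (Λ * β ^ n) a k := by
  rw [T, sum_biUnion, Matrix.mul_apply, ← sum_add_distrib]
  · refine sum_congr rfl fun m _ => ?_
    rw [sum_union, sum_image (by intro x _ y _ h; simpa using h),
      sum_image (by intro x _ y _ h; simpa using h), ← sum_R β Λ, mul_sum, mul_sum]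
    · rfl
    · rw [Finset.disjoint_left]
      intro t h1 h2
      simp only [mem_image] at h1 h2
      obtain ⟨u, _, rfl⟩ := h1
      obtain ⟨v, _, h⟩ := h2
      simp at h
  · intro x _ y _ hxy
    rw [Function.onFun, Finset.disjoint_left]
    intro t h1 h2
    simp only [mem_image, mem_union] at h1 h2
    obtain ⟨u, _, rfl⟩ | ⟨u, _, rfl⟩ := h1 <;> obtain ⟨v, _, h⟩ | ⟨v, _, h⟩ := h2 <;>
    · simp only [List.cons.injEq, Prod.mk.injEq] at h
      exact hxy h.1.2.symm

open Matrix in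
theorem sum_T (β Λ : Matrix (Fin d) (Fin d) ℝ) (n : ℕ) (a k : Fin d) :
    ∑ t ∈ T (n + 1) a k, MWalk.weightFrom (fun a b => β a b) (fun a b => Λ a b) a t =
      (∑ p ∈ antidiagonal n, (βᵀ ^ p.1 * Λ) * β ^ p.2) a k := by
  induction n generalizing a with
  | zero => rw [sum_T_succ]; simp [T]
  | succ n ih =>
    rw [sum_T_succ, Finset.Nat.antidiagonal_succ]
    simp only [ih, sum_cons, sum_map, Matrix.add_apply]
    rw [add_comm]
    congr 1
    · simp
    · simp only [Function.Embedding.prodMap, Function.Embedding.coeFn_mk, Prod.map,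
        Nat.succ_eq_add_one, Function.Embedding.refl_apply, pow_succ']
      simp_rw [Matrix.mul_assoc]
      rw [← Matrix.mul_sum, Matrix.mul_apply]
      simp [Matrix.transpose_apply]

theorem valid_of_weight (G : MixedGraph (Fin d)) (β Λ : Matrix (Fin d) (Fin d) ℝ)
    (hβc : ∀ a b, β a b ≠ 0 → G.dir a b) (hΛc : ∀ a b, Λ a b ≠ 0 → G.bi a b)
    (a : Fin d) (t : List (EKind × Fin d))
    (h : MWalk.weightFrom (fun a b => β a b) (fun a b => Λ a b) a t ≠ 0) :
    MWalk.Valid G a t := by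
  induction t generalizing a with
  | nil => trivial
  | cons s t ih =>
    obtain ⟨e, v⟩ := s
    have h1 := left_ne_zero_of_mul h
    have h2 := right_ne_zero_of_mul h
    refine ⟨?_, ih _ h2⟩
    cases e
    · exact hβc _ _ h1
    · exact hβc _ _ h1
    · exact hΛc _ _ h1

open Matrix in
theorem finsum_trek (G : MixedGraph (Fin d)) (β Λ : Matrix (Fin d) (Fin d) ℝ)
    (hβc : ∀ a b, β a b ≠ 0 → G.dir a b) (hΛc : ∀ a b, Λ a b ≠ 0 → G.bi a b)
    (j k : Fin d) (q : ℕ) :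
    ∑ᶠ w ∈ {w : MWalk (Fin d) | MWalk.IsWalkFrom G w j k ∧ w.IsTrek ∧ w.length = q + 1},
      w.weight (fun a b => β a b) (fun a b => Λ a b) =
      (∑ p ∈ antidiagonal q, (βᵀ ^ p.1 * Λ) * β ^ p.2) j k := by
  classical
  have hinj : Function.Injective (MWalk.mk j : List (EKind × Fin d) → MWalk (Fin d)) := by
    intro x y h; simpa using h
  rw [← sum_T]
  rw [finsum_mem_eq_sum_of_inter_support_eq (t := (T (q + 1) j k).map ⟨MWalk.mk j, hinj⟩)]
  · rw [sum_map]; rfl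
  · ext ⟨v, t⟩
    simp only [Set.mem_inter_iff, Set.mem_setOf_eq, Function.mem_support, and_congr_left_iff]
    intro hw
    simp only [coe_map, Function.Embedding.coeFn_mk, Set.mem_image, mem_coe, MWalk.mk.injEq]
    constructor
    · rintro ⟨⟨h1, h2, h3⟩, h4, h5⟩
      simp only at h2
      subst h2
      exact ⟨t, (mem_T _ _ _ _).2 ⟨h4, h5, h3⟩, rfl, rfl⟩
    · rintro ⟨t', ht, rfl, rfl⟩
      obtain ⟨h1, h2, h3⟩ := (mem_T _ _ _ _).1 ht
      refine ⟨⟨⟨?_, valid_of_weight G β Λ hβc hΛc _ _ hw⟩, rfl, h3⟩, h1, h2⟩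
      rintro h
      simp only at h
      simp [h] at h2

section Norm

attribute [local instance] Matrix.linftyOpNormedRing Matrix.linftyOpNormedAlgebra
  Matrix.linftyOpNormedAddCommGroup Matrix.linftyOpNormedSpace

theorem summable_complex (b : Matrix (Fin d) (Fin d) ℂ) (h : spectralRadius ℂ b < 1) :
    Summable fun n : ℕ => b ^ n := by
  have hc : CompleteSpace (Matrix (Fin d) (Fin d) ℂ) := FiniteDimensional.complete ℂ _
  obtain ⟨r, hr, hr1⟩ := ENNReal.lt_iff_exists_nnreal_btwn.1 h
  have hr1' : r < 1 := by exact_mod_cast hr1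
  have ht := (spectrum.pow_nnnorm_pow_one_div_tendsto_nhds_spectralRadius b).eventually_lt_const hr
  refine Summable.of_norm_bounded_eventually_nat (g := fun n => (r : ℝ) ^ n)
    (summable_geometric_of_lt_one r.2 (by exact_mod_cast hr1')) ?_
  filter_upwards [ht, Filter.eventually_gt_atTop 0] with n hn hn0
  have hn' : (n : ℝ) ≠ 0 := by positivity
  have := ENNReal.rpow_le_rpow hn.le (by positivity : (0 : ℝ) ≤ n)
  rw [← ENNReal.rpow_mul, one_div_mul_cancel hn', ENNReal.rpow_one, ENNReal.rpow_natCast] at this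
  exact_mod_cast this

theorem summable_real (β : Matrix (Fin d) (Fin d) ℝ)
    (h : spectralRadius ℂ (β.map Complex.ofReal) < 1) :
    Summable fun n : ℕ => β ^ n := by
  have h1 := summable_complex _ h
  refine Pi.summable.2 fun i => Pi.summable.2 fun j => ?_
  have h2 := Pi.summable.1 (Pi.summable.1 h1 i) j
  rw [← Complex.summable_ofReal]
  convert h2 using 2 with n
  have := (Complex.ofRealHom.mapMatrix (m := Fin d)).map_pow β n
  exact congrFun (congrFun this i) j

open Matrix in
theorem hasSum_aux (β Λ : Matrix (Fin d) (Fin d) ℝ)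
    (h : spectralRadius ℂ (β.map Complex.ofReal) < 1) :
    HasSum (fun q : ℕ => ∑ p ∈ antidiagonal q, (βᵀ ^ p.1 * Λ) * β ^ p.2)
      (((1 - β)⁻¹)ᵀ * Λ * (1 - β)⁻¹) := by
  have hc : CompleteSpace (Matrix (Fin d) (Fin d) ℝ) := FiniteDimensional.complete ℝ _
  have hs := summable_real β h
  have hinv : (1 - β)⁻¹ = ∑' n : ℕ, β ^ n := Matrix.inv_eq_right_inv hs.one_sub_mul_tsum_pow
  have hT : Summable fun n : ℕ => βᵀ ^ n := by
    simpa only [Matrix.transpose_pow] using hs.matrix_transpose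
  have hTinv : ((1 - β)⁻¹)ᵀ = ∑' n : ℕ, βᵀ ^ n := by
    rw [hinv, Matrix.transpose_tsum]
    simp only [Matrix.transpose_pow]
  have hTL : Summable fun n : ℕ => βᵀ ^ n * Λ := hT.mul_right Λ
  have hf : Summable fun n : ℕ => ‖βᵀ ^ n * Λ‖ := summable_norm_iff.2 hTL
  have hg : Summable fun n : ℕ => ‖β ^ n‖ := summable_norm_iff.2 hs
  rw [hTinv, hinv, ← hT.tsum_mul_right]
  have H := (summable_norm_sum_mul_antidiagonal_of_summable_norm hf hg).of_norm.hasSum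
  rw [← tsum_mul_tsum_eq_tsum_sum_antidiagonal_of_summable_norm hf hg] at H
  exact H

end Norm

end TrekAux

open Matrix in
/-- The trek rule: each entry of the covariance matrix
`Σ = (I - β)⁻ᵀ Λ (I - β)⁻¹` of a stable Gaussian linear system is the sum over
`q ≥ 1` of the total weight of treks of length `q`, the series converging
absolutely. -/
theorem trek_rule (d : ℕ) (G : MixedGraph (Fin d)) (hsymm : G.BiSymm)
    (β Λ : Matrix (Fin d) (Fin d) ℝ)
    (hβc : ∀ a b, β a b ≠ 0 → G.dir a b) (hΛc : ∀ a b, Λ a b ≠ 0 → G.bi a b)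
    (hΛsym : Λ.IsSymm) (hpsd : Λ.PosSemidef)
    (hρ : spectralRadius ℂ (β.map Complex.ofReal) < 1) :
    ∀ Sm : Matrix (Fin d) (Fin d) ℝ, Sm = ((1 - β)⁻¹)ᵀ * Λ * (1 - β)⁻¹ →
      ∀ j k : Fin d,
        (Summable fun q : ℕ =>
          |∑ᶠ w ∈ {w : MWalk (Fin d) | MWalk.IsWalkFrom G w j k ∧
              w.IsTrek ∧ w.length = q + 1},
            w.weight (fun a b => β a b) (fun a b => Λ a b)|) ∧
        HasSum
          (fun q : ℕ =>
            ∑ᶠ w ∈ {w : MWalk (Fin d) | MWalk.IsWalkFrom G w j k ∧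
                w.IsTrek ∧ w.length = q + 1},
              w.weight (fun a b => β a b) (fun a b => Λ a b))
          (Sm j k) := by
  rintro Sm rfl j k
  have h := Pi.hasSum.1 (Pi.hasSum.1 (TrekAux.hasSum_aux β Λ hρ) j) k
  have h2 : HasSum
          (fun q : ℕ =>
            ∑ᶠ w ∈ {w : MWalk (Fin d) | MWalk.IsWalkFrom G w j k ∧
                w.IsTrek ∧ w.length = q + 1},
              w.weight (fun a b => β a b) (fun a b => Λ a b))
          ((((1 - β)⁻¹)ᵀ * Λ * (1 - β)⁻¹ : Matrix (Fin d) (Fin d) ℝ) j k) := by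
    simp only [TrekAux.finsum_trek G β Λ hβc hΛc]
    exact h
  exact ⟨h2.summable.abs, h2⟩
end

section
/- (Wright's path analysis) Let G be an acyclic directed mixed graph on V = {1, …, d}, and let β, Λ ∈ ℝ^{d×d} be compatible with G with Λ symmetric positive semi-definite. Then I − β is invertible; set Σ = (I − β)^{-T} Λ (I − β)^{-1}. For all j ≠ k: Σ_{jk} = Σ_{trek paths p from j to k} weight(p) + Σ_{r ∈ V} ( Σ_{d-connected paths p from j to k with root r} Π_{edges l → m of p} β_{lm} ) · Σ_{rr}, where the root of a d-connected path is its unique vertex at which neither incident edge-traversal (if any) has an arrowhead, and all sums are over the finitely many such paths. -/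
/-- The root of a d-connected walk: the unique vertex on it at which no
incident edge-traversal has an arrowhead (the meeting point of the backward
and forward segments). -/
def MWalk.RootAt {V : Type*} (w : MWalk V) (r : V) : Prop :=
  ∃ l rr : List (EKind × V), w.tail = l ++ rr ∧ (∀ s ∈ l, s.1 = EKind.bwd) ∧
    (∀ s ∈ rr, s.1 = EKind.fwd) ∧
    ((l = [] ∧ w.head = r) ∨ ∃ s : EKind × V, l.getLast? = some s ∧ s.2 = r)


namespace Wright

open Finset

theorem finsum_split {L α : Type*} [Fintype α] (nil : L) (e : α → L → L) (p : L → Option α)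
    (h1 : ∀ s, Function.Injective (e s)) (h2 : ∀ t, p t = none ↔ t = nil)
    (h3 : ∀ t s, p t = some s ↔ t ∈ Set.range (e s)) (f : L → ℝ)
    (hf : (Function.support f).Finite) :
    ∑ᶠ t, f t = f nil + ∑ s, ∑ᶠ t, f (e s t) := by
  classical
  have key : ∀ t, f t = (if t = nil then f nil else 0) +
      ∑ s, (if p t = some s then f t else 0) := by
    intro t
    rcases h : p t with _ | s
    · have := (h2 t).1 h
      simp [this]
    · have : t ≠ nil := fun h' => by rw [(h2 t).2 h'] at h; simp at h
      simp [this]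
  have hs : ∀ s, (Function.support (fun t => if p t = some s then f t else 0)).Finite := by
    intro s
    refine hf.subset ?_
    intro t ht
    simp only [Function.mem_support] at ht ⊢
    intro h; apply ht; simp [h]
  rw [finsum_congr key, finsum_add_distrib]
  · congr 1
    · rw [finsum_eq_single _ nil]
      · simp
      · intro x hx; simp [hx]
    · rw [finsum_sum_comm]
      · refine Finset.sum_congr rfl fun s _ => ?_
        have : ∀ t, (if p t = some s then f t else 0) = ∑ᶠ (_ : t ∈ Set.range (e s)), f t := by
          intro t
          rw [finsum_eq_if]
          by_cases h : p t = some s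
          · rw [if_pos h, if_pos ((h3 t s).1 h)]
          · rw [if_neg h, if_neg (fun h' => h ((h3 t s).2 h'))]
        rw [finsum_congr this, finsum_mem_range (h1 s)]
      · intro s _; exact hs s
  · refine (Set.finite_singleton nil).subset ?_
    intro t ht
    by_contra h
    apply ht
    have : t ≠ nil := h
    simp [this]
  · refine hf.subset ?_
    intro t ht
    simp only [Function.mem_support] at ht ⊢
    intro h; apply ht; simp [h]

theorem finsum_cons {α : Type*} [Fintype α] (f : List α → ℝ)
    (hf : (Function.support f).Finite) :
    ∑ᶠ t, f t = f [] + ∑ s, ∑ᶠ t, f (s :: t) := by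
  refine finsum_split [] (fun s t => s :: t) List.head? ?_ ?_ ?_ f hf
  · intro s a b h; simpa using h
  · intro t; simp
  · intro t s
    cases t with
    | nil => simp
    | cons a t => simp [eq_comm]

theorem finsum_snoc {α : Type*} [Fintype α] (f : List α → ℝ)
    (hf : (Function.support f).Finite) :
    ∑ᶠ t, f t = f [] + ∑ s, ∑ᶠ t, f (t ++ [s]) := by
  refine finsum_split [] (fun s t => t ++ [s]) List.getLast? ?_ ?_ ?_ f hf
  · intro s a b h; simpa using h
  · intro t; simp
  · intro t s
    rw [List.getLast?_eq_some_iff]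
    simp [eq_comm]

instance : Fintype EKind := ⟨{.fwd, .bwd, .bidir}, fun x => by cases x <;> simp⟩

theorem sum_steps {V : Type*} [Fintype V] (f : EKind × V → ℝ) :
    ∑ s, f s = ∑ m, f (.fwd, m) + ∑ m, f (.bwd, m) + ∑ m, f (.bidir, m) := by
  rw [Fintype.sum_prod_type]
  have : (Finset.univ : Finset EKind) = {.fwd, .bwd, .bidir} := rfl
  rw [this]
  simp [add_assoc]

variable {V : Type*}

abbrev St (V : Type*) := List (EKind × V)

def lst (a : V) (t : St V) : V := (t.map Prod.snd).getLastD a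

@[simp] theorem lst_nil (a : V) : lst a [] = a := rfl
@[simp] theorem lst_cons (a : V) (s) (t : St V) : lst a (s :: t) = lst s.2 t := by
  unfold lst
  rw [List.map_cons, List.getLastD_cons]
@[simp] theorem lst_snoc (a : V) (s) (t : St V) : lst a (t ++ [s]) = s.2 := by
  simp [lst]

theorem lst_mem (a : V) (t : St V) : lst a t ∈ a :: t.map Prod.snd := by
  induction t generalizing a with
  | nil => simp
  | cons s t ih => rw [lst_cons]; exact List.mem_cons_of_mem _ (by simpa using ih s.2)

def fw (β : V → V → ℝ) : V → St V → ℝ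
  | _, [] => 1
  | a, (.fwd, b) :: t => β a b * fw β b t
  | _, _ => 0

def bw (β : V → V → ℝ) : V → St V → ℝ
  | _, [] => 1
  | a, (.bwd, b) :: t => β b a * bw β b t
  | _, _ => 0

def W (β Λ : V → V → ℝ) (S : V → ℝ) : V → St V → ℝ
  | a, [] => S a
  | a, (.fwd, b) :: t => S a * (β a b * fw β b t)
  | a, (.bwd, b) :: t => β b a * W β Λ S b t
  | a, (.bidir, b) :: t => Λ a b * fw β b t

section
variable (β Λ : V → V → ℝ) (S : V → ℝ)

theorem fw_snoc (a b : V) (t : St V) :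
    fw β a (t ++ [(.fwd, b)]) = fw β a t * β (lst a t) b := by
  induction t generalizing a with
  | nil => simp [fw]
  | cons s t ih =>
    obtain ⟨k, v⟩ := s
    cases k <;> simp [fw, ih, mul_assoc]

theorem fw_snoc_ne (a : V) (s : EKind × V) (hs : s.1 ≠ .fwd) (t : St V) :
    fw β a (t ++ [s]) = 0 := by
  induction t generalizing a with
  | nil =>
    obtain ⟨k, v⟩ := s
    cases k <;> simp_all [fw]
  | cons s t ih =>
    obtain ⟨k, v⟩ := s
    cases k <;> simp [fw, ih]

theorem W_snoc_fwd (a b : V) (t : St V) :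
    W β Λ S a (t ++ [(.fwd, b)]) = W β Λ S a t * β (lst a t) b := by
  induction t generalizing a with
  | nil => simp [W, fw]
  | cons s t ih =>
    obtain ⟨k, v⟩ := s
    cases k <;> simp [W, ih, fw_snoc, mul_assoc]

theorem W_snoc_bidir (a b : V) (t : St V) :
    W β Λ S a (t ++ [(.bidir, b)]) = bw β a t * Λ (lst a t) b := by
  induction t generalizing a with
  | nil => simp [W, bw, fw]
  | cons s t ih =>
    obtain ⟨k, v⟩ := s
    cases k <;> simp [W, ih, bw, fw_snoc_ne, mul_assoc]

theorem W_snoc_bwd (a b : V) (t : St V) :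
    W β Λ S a (t ++ [(.bwd, b)]) = bw β a t * β b (lst a t) * S b := by
  induction t generalizing a with
  | nil => simp [W, bw]
  | cons s t ih =>
    obtain ⟨k, v⟩ := s
    cases k <;> simp [W, ih, bw, fw_snoc_ne, mul_assoc]

variable {β} {R : V → V → Prop} (hR : ∀ a b, β a b ≠ 0 → R a b)
include hR

theorem fw_anc {a : V} {t : St V} (h : fw β a t ≠ 0) :
    ∀ v ∈ a :: t.map Prod.snd, Relation.ReflTransGen R v (lst a t) := by
  induction t generalizing a with
  | nil => intro v hv; simp at hv; subst hv; exact .refl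
  | cons s t ih =>
    obtain ⟨k, b⟩ := s
    cases k <;> simp only [fw, ne_eq, mul_eq_zero, not_or, not_true_eq_false] at h
    intro v hv
    rw [lst_cons]
    rcases List.mem_cons.1 hv with rfl | hv
    · exact .head (hR _ _ h.1) (ih h.2 b (by simp))
    · exact ih h.2 v hv

theorem fw_desc {a : V} {t : St V} (h : fw β a t ≠ 0) :
    ∀ v ∈ t.map Prod.snd, Relation.TransGen R a v := by
  induction t generalizing a with
  | nil => intro v hv; simp at hv
  | cons s t ih =>
    obtain ⟨k, b⟩ := s
    cases k <;> simp only [fw, ne_eq, mul_eq_zero, not_or, not_true_eq_false] at h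
    intro v hv
    rcases List.mem_cons.1 hv with rfl | hv
    · exact .single (hR _ _ h.1)
    · exact .head (hR _ _ h.1) (ih h.2 v hv)

theorem bw_anc {a : V} {t : St V} (h : bw β a t ≠ 0) :
    ∀ v ∈ t.map Prod.snd, Relation.TransGen R v a := by
  induction t generalizing a with
  | nil => intro v hv; simp at hv
  | cons s t ih =>
    obtain ⟨k, b⟩ := s
    cases k <;> simp only [bw, ne_eq, mul_eq_zero, not_or, not_true_eq_false] at h
    intro v hv
    rcases List.mem_cons.1 hv with rfl | hv
    · exact .single (hR _ _ h.1)
    · exact .tail (ih h.2 v hv) (hR _ _ h.1)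

theorem bw_anc' {a : V} {t : St V} (h : bw β a t ≠ 0) :
    ∀ v ∈ a :: t.map Prod.snd, Relation.ReflTransGen R v a := by
  intro v hv
  rcases List.mem_cons.1 hv with rfl | hv
  · exact .refl
  · exact (bw_anc hR h v hv).to_reflTransGen

theorem W_anc {a : V} {t : St V} (h : W β Λ S a t ≠ 0) :
    ∀ v ∈ a :: t.map Prod.snd, Relation.ReflTransGen R v a ∨
      Relation.ReflTransGen R v (lst a t) := by
  induction t generalizing a with
  | nil => intro v hv; simp at hv; subst hv; exact .inl .refl
  | cons s t ih =>
    obtain ⟨k, b⟩ := s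
    intro v hv
    rw [lst_cons]
    rcases List.mem_cons.1 hv with rfl | hv
    · exact .inl .refl
    cases k <;> simp only [W, ne_eq, mul_eq_zero, not_or] at h
    · exact .inr (fw_anc hR h.2.2 v hv)
    · rcases ih h.2 v hv with h' | h'
      · exact .inl (h'.tail (hR _ _ h.1))
      · exact .inr h'
    · exact .inr (fw_anc hR h.2 v hv)

variable (hac : ∀ v, ¬ Relation.TransGen R v v)
include hac

theorem fw_nodup {a : V} {t : St V} (h : fw β a t ≠ 0) : (a :: t.map Prod.snd).Nodup := by
  induction t generalizing a with
  | nil => simp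
  | cons s t ih =>
    rw [List.nodup_cons]
    refine ⟨fun hm => hac _ (fw_desc hR h a hm), ?_⟩
    obtain ⟨k, b⟩ := s
    cases k <;> simp only [fw, ne_eq, mul_eq_zero, not_or, not_true_eq_false] at h
    exact ih h.2

theorem bw_nodup {a : V} {t : St V} (h : bw β a t ≠ 0) : (a :: t.map Prod.snd).Nodup := by
  induction t generalizing a with
  | nil => simp
  | cons s t ih =>
    rw [List.nodup_cons]
    refine ⟨fun hm => hac _ (bw_anc hR h a hm), ?_⟩
    obtain ⟨k, b⟩ := s
    cases k <;> simp only [bw, ne_eq, mul_eq_zero, not_or, not_true_eq_false] at h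
    exact ih h.2

end

theorem finite_nodup [Fintype V] (a : V) : {t : St V | (a :: t.map Prod.snd).Nodup}.Finite := by
  refine (List.finite_length_le (EKind × V) (Fintype.card V)).subset ?_
  intro t ht
  have := List.Nodup.length_le_card (List.nodup_cons.1 ht).2
  simpa using this

theorem finite_supp [Fintype V] (a : V) (f : St V → ℝ)
    (h : ∀ t, f t ≠ 0 → (a :: t.map Prod.snd).Nodup) : (Function.support f).Finite :=
  (finite_nodup a).subset fun t ht => h t ht

section sums
open Classical in
noncomputable def Fw (β : V → V → ℝ) (a k : V) : ℝ := ∑ᶠ t, if lst a t = k then fw β a t else 0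
open Classical in
noncomputable def Bw (β : V → V → ℝ) (a k : V) : ℝ := ∑ᶠ t, if lst a t = k then bw β a t else 0
open Classical in
noncomputable def phi (β Λ : V → V → ℝ) (S : V → ℝ) (j k : V) (t : St V) : ℝ :=
  if (j :: t.map Prod.snd).Nodup ∧ lst j t = k then W β Λ S j t else 0

variable [Fintype V] {β Λ : V → V → ℝ} {S : V → ℝ} {R : V → V → Prop}

theorem phi_supp (j k : V) : (Function.support (phi β Λ S j k)).Finite := by
  refine finite_supp j _ fun t ht => ?_
  by_contra h
  apply ht
  rw [phi, if_neg (fun h' => h h'.1)]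

variable (hR : ∀ a b, β a b ≠ 0 → R a b) (hac : ∀ v, ¬ Relation.TransGen R v v)
include hR hac

open Classical in
theorem Fw_supp (a k : V) :
    (Function.support (fun t => if lst a t = k then fw β a t else 0)).Finite := by
  refine finite_supp a _ fun t ht => fw_nodup hR hac (a := a) (t := t) ?_
  intro h; apply ht; simp [h]

open Classical in
theorem Bw_supp (a k : V) :
    (Function.support (fun t => if lst a t = k then bw β a t else 0)).Finite := by
  refine finite_supp a _ fun t ht => bw_nodup hR hac (a := a) (t := t) ?_
  intro h; apply ht; simp [h]

open Classical in
theorem Fw_rec (a k : V) : Fw β a k = (if a = k then 1 else 0) + ∑ m, β a m * Fw β m k := by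
  rw [Fw, finsum_cons _ (Fw_supp hR hac a k), sum_steps]
  simp [fw, Fw, mul_finsum]
  by_cases h : a = k
  · exact (if_pos h).trans (if_pos h).symm
  · exact (if_neg h).trans (if_neg h).symm

open Classical in
theorem Bw_rec (a k : V) : Bw β a k = (if a = k then 1 else 0) + ∑ m, β m a * Bw β m k := by
  rw [Bw, finsum_cons _ (Bw_supp hR hac a k), sum_steps]
  simp [bw, Bw, mul_finsum]
  by_cases h : a = k
  · exact (if_pos h).trans (if_pos h).symm
  · exact (if_neg h).trans (if_neg h).symm

/-- Strip the first step. -/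
theorem phi_cons {j k : V} (hjk : j ≠ k) (h : ¬ Relation.TransGen R j k) :
    ∑ᶠ t, phi β Λ S j k t = ∑ m, β m j * (∑ᶠ t, phi β Λ S m k t) + ∑ m, Λ j m * Fw β m k := by
  classical
  have hn : ¬ Relation.ReflTransGen R j k := by
    intro h'
    rcases Relation.reflTransGen_iff_eq_or_transGen.1 h' with h' | h'
    · exact hjk h'.symm
    · exact h h'
  rw [finsum_cons _ (phi_supp j k), sum_steps]
  have h0 : phi β Λ S j k [] = 0 := by simp [phi, hjk]
  have h1 : ∀ m t, phi β Λ S j k ((.fwd, m) :: t) = 0 := by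
    intro m t
    by_contra hne
    unfold phi at hne
    split_ifs at hne with hc
    · simp only [W, mul_eq_zero, not_or] at hne
      have := fw_anc hR hne.2.2 m (by simp)
      have h2 := hc.2
      rw [lst_cons] at h2
      simp only at h2
      rw [h2] at this
      exact hn (.head (hR _ _ hne.2.1) this)
    · exact hne rfl
  have h2 : ∀ m t, phi β Λ S j k ((.bwd, m) :: t) = β m j * phi β Λ S m k t := by
    intro m t
    by_cases hb : β m j = 0
    · simp [phi, W, hb]
    by_cases hw : W β Λ S m t = 0
    · simp [phi, W, hw]
    unfold phi
    rw [mul_ite, mul_zero]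
    refine if_congr ?_ rfl rfl
    rw [lst_cons, List.map_cons, List.nodup_cons]
    constructor
    · rintro ⟨⟨_, a⟩, b⟩; exact ⟨a, b⟩
    · rintro ⟨a, b⟩
      refine ⟨⟨fun hm => ?_, a⟩, b⟩
      rcases W_anc Λ S hR hw j hm with h' | h'
      · exact hac _ (Relation.TransGen.tail' h' (hR _ _ hb))
      · rw [b] at h'; exact hn h'
  have h3 : ∀ m t, phi β Λ S j k ((.bidir, m) :: t) =
      Λ j m * (if lst m t = k then fw β m t else 0) := by
    intro m t
    by_cases hw : fw β m t = 0
    · simp [phi, W, hw]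
    unfold phi
    rw [mul_ite, mul_zero]
    refine if_congr ?_ rfl rfl
    rw [lst_cons, List.map_cons, List.nodup_cons]
    constructor
    · rintro ⟨⟨_, a⟩, b⟩; exact b
    · intro b
      refine ⟨⟨fun hm => ?_, fw_nodup hR hac hw⟩, b⟩
      have := fw_anc hR hw j hm
      rw [b] at this; exact hn this
  simp [h0, h1, h2, h3, mul_finsum, Fw]

theorem phi_snoc {j k : V} (hjk : j ≠ k) (h : ¬ Relation.TransGen R k j) :
    ∑ᶠ t, phi β Λ S j k t = ∑ m, (∑ᶠ t, phi β Λ S j m t) * β m k + ∑ m, Bw β j m * Λ m k := by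
  classical
  have hn : ¬ Relation.ReflTransGen R k j := by
    intro h'
    rcases Relation.reflTransGen_iff_eq_or_transGen.1 h' with h' | h'
    · exact hjk h'
    · exact h h'
  rw [finsum_snoc _ (phi_supp j k), sum_steps]
  have h0 : phi β Λ S j k [] = 0 := by simp [phi, hjk]
  have hx : ∀ e m t, m ≠ k → phi β Λ S j k (t ++ [(e, m)]) = 0 := by
    intro e m t hm
    simp [phi, hm]
  have hnd : ∀ e (t : St V), (j :: (t ++ [(e, k)]).map Prod.snd).Nodup ↔
      (j :: t.map Prod.snd).Nodup ∧ k ∉ j :: t.map Prod.snd := by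
    intro e t
    rw [List.map_append, ← List.cons_append, List.nodup_append]
    simp only [List.map_cons, List.map_nil, List.nodup_singleton, true_and, List.mem_singleton]
    constructor
    · rintro ⟨a, b⟩; exact ⟨a, fun hk => b k hk k rfl rfl⟩
    · rintro ⟨a, b⟩; exact ⟨a, fun x hx y hy hxy => b (by rw [← hy, ← hxy]; exact hx)⟩
  have h2 : ∀ t, phi β Λ S j k (t ++ [(.bwd, k)]) = 0 := by
    intro t
    by_contra hne
    unfold phi at hne
    split_ifs at hne with hc
    · rw [W_snoc_bwd] at hne
      simp only [mul_eq_zero, not_or] at hne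
      have := bw_anc' hR hne.1.1 _ (lst_mem j t)
      exact hn (.head (hR _ _ hne.1.2) this)
    · exact hne rfl
  have h1 : ∀ t, phi β Λ S j k (t ++ [(.fwd, k)]) = ∑ m, phi β Λ S j m t * β m k := by
    intro t
    rw [Finset.sum_eq_single (lst j t)]
    · by_cases hb : β (lst j t) k = 0
      · simp [phi, W_snoc_fwd, hb]
      by_cases hw : W β Λ S j t = 0
      · simp [phi, W_snoc_fwd, hw]
      unfold phi
      rw [ite_mul, zero_mul, W_snoc_fwd]
      refine if_congr ?_ rfl rfl
      rw [hnd, lst_snoc]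
      constructor
      · rintro ⟨⟨a, _⟩, _⟩; exact ⟨a, rfl⟩
      · rintro ⟨a, _⟩
        refine ⟨⟨a, fun hm => ?_⟩, rfl⟩
        rcases W_anc Λ S hR hw k hm with h' | h'
        · exact hn h'
        · exact hac _ (Relation.TransGen.tail' h' (hR _ _ hb))
    · intro m _ hm
      simp [phi, hm.symm]
    · simp
  have h3 : ∀ t, phi β Λ S j k (t ++ [(.bidir, k)]) =
      ∑ m, (if lst j t = m then bw β j t else 0) * Λ m k := by
    intro t
    simp only [ite_mul, zero_mul, Finset.sum_ite_eq, Finset.mem_univ, if_true]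
    by_cases hw : bw β j t = 0
    · simp [phi, W_snoc_bidir, hw]
    unfold phi
    rw [W_snoc_bidir, if_pos]
    rw [hnd, lst_snoc]
    exact ⟨⟨bw_nodup hR hac hw, fun hm => hn (bw_anc' hR hw k hm)⟩, rfl⟩
  rw [h0, zero_add,
    Finset.sum_eq_single k (fun m _ hm => by simp [hx _ m _ hm]) (by simp),
    Finset.sum_eq_single k (fun m _ hm => by simp [hx _ m _ hm]) (by simp),
    Finset.sum_eq_single k (fun m _ hm => by simp [hx _ m _ hm]) (by simp)]
  simp only [h1, h2, h3, finsum_zero, add_zero]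
  rw [finsum_sum_comm, finsum_sum_comm]
  · simp only [finsum_mul, Bw]
  · intro m _
    refine (Bw_supp hR hac j m).subset ?_
    intro t ht hz
    apply ht
    simp only at hz ⊢
    rw [hz, zero_mul]
  · intro m _
    refine (phi_supp (β := β) (Λ := Λ) (S := S) j m).subset ?_
    intro t ht hz
    apply ht
    simp only at hz ⊢
    rw [hz, zero_mul]

end sums

theorem phi_diag (β Λ : V → V → ℝ) (S : V → ℝ) (j : V) : ∑ᶠ t, phi β Λ S j j t = S j := by
  classical
  rw [finsum_eq_single _ []]
  · simp [phi, W]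
  · intro t ht
    rw [phi, if_neg]
    rintro ⟨h1, h2⟩
    cases t with
    | nil => exact ht rfl
    | cons s t =>
      rw [lst_cons] at h2
      have := lst_mem s.2 t
      rw [h2] at this
      exact (List.nodup_cons.1 h1).1 this

/-! Shapes -/

theorem weight_fwd (β Λ : V → V → ℝ) (a : V) (t : St V) (h : ∀ s ∈ t, s.1 = EKind.fwd) :
    MWalk.weightFrom β Λ a t = fw β a t := by
  induction t generalizing a with
  | nil => rfl
  | cons s t ih =>
    obtain ⟨k, b⟩ := s
    have hk : k = .fwd := h (k, b) (by simp)
    subst hk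
    simp [MWalk.weightFrom, fw, ih b (fun s hs => h s (List.mem_cons_of_mem _ hs))]

theorem fw_zero (β : V → V → ℝ) (a : V) (t : St V) (h : ¬ ∀ s ∈ t, s.1 = EKind.fwd) :
    fw β a t = 0 := by
  induction t generalizing a with
  | nil => simp at h
  | cons s t ih =>
    obtain ⟨k, b⟩ := s
    cases k with
    | fwd =>
      have : ¬ ∀ s ∈ t, s.1 = EKind.fwd := fun h' => h (by simpa using h')
      simp [fw, ih b this]
    | bwd => rfl
    | bidir => rfl

theorem trek_nil (a : V) : ¬ MWalk.IsTrek (⟨a, []⟩ : MWalk V) := by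
  rintro ⟨l, b, r, h, _⟩; simp at h

theorem trek_bwd (a b : V) (t : St V) :
    MWalk.IsTrek ⟨a, (.bwd, b) :: t⟩ ↔ MWalk.IsTrek ⟨b, t⟩ := by
  constructor
  · rintro ⟨l, c, r, h, h1, h2, h3⟩
    cases l with
    | nil =>
      simp at h
      rw [← h.1] at h2; simp at h2
    | cons x l =>
      simp at h
      exact ⟨l, c, r, h.2, fun s hs => h1 s (List.mem_cons_of_mem _ hs), h2, h3⟩
  · rintro ⟨l, c, r, h, h1, h2, h3⟩
    simp only at h
    refine ⟨(.bwd, b) :: l, c, r, by simp [h], ?_, h2, h3⟩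
    intro s hs
    rcases List.mem_cons.1 hs with rfl | hs
    · rfl
    · exact h1 s hs

theorem trek_fwd (a b : V) (t : St V) : ¬ MWalk.IsTrek ⟨a, (.fwd, b) :: t⟩ := by
  rintro ⟨l, c, r, h, h1, h2, h3⟩
  cases l with
  | nil => simp at h; rw [← h.1] at h2; simp at h2
  | cons x l =>
    simp at h
    have := h1 x (by simp)
    rw [← h.1] at this; simp at this

theorem trek_bidir (a b : V) (t : St V) :
    MWalk.IsTrek ⟨a, (.bidir, b) :: t⟩ ↔ ∀ s ∈ t, s.1 = EKind.fwd := by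
  constructor
  · rintro ⟨l, c, r, h, h1, h2, h3⟩
    cases l with
    | nil => simp at h; rw [h.2]; exact h3
    | cons x l =>
      simp at h
      have := h1 x (by simp)
      rw [← h.1] at this; simp at this
  · intro h
    exact ⟨[], (.bidir, b), t, by simp, by simp, rfl, h⟩

theorem root_nil (a r : V) : MWalk.RootAt (⟨a, []⟩ : MWalk V) r ↔ a = r := by
  constructor
  · rintro ⟨l, rr, h, h1, h2, h3⟩
    simp at h
    simpa [h.1] using h3
  · rintro rfl
    exact ⟨[], [], by simp⟩

theorem root_bwd (a b r : V) (t : St V) :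
    MWalk.RootAt ⟨a, (.bwd, b) :: t⟩ r ↔ MWalk.RootAt ⟨b, t⟩ r := by
  constructor
  · rintro ⟨l, rr, h, h1, h2, h3⟩
    cases l with
    | nil =>
      simp at h
      have := h2 (.bwd, b) (by rw [← h]; simp)
      simp at this
    | cons x l =>
      simp at h
      refine ⟨l, rr, h.2, fun s hs => h1 s (List.mem_cons_of_mem _ hs), h2, ?_⟩
      rcases h3 with h3 | ⟨s, h3, h4⟩
      · simp at h3
      · cases l with
        | nil =>
          left
          simp at h3
          refine ⟨rfl, ?_⟩
          rw [← h4, ← h3, ← h.1]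
        | cons y l =>
          right
          exact ⟨s, by simpa [List.getLast?_cons_cons] using h3, h4⟩
  · rintro ⟨l, rr, h, h1, h2, h3⟩
    simp only at h
    refine ⟨(.bwd, b) :: l, rr, by simp [h], ?_, h2, ?_⟩
    · intro s hs
      rcases List.mem_cons.1 hs with rfl | hs
      · rfl
      · exact h1 s hs
    · right
      rcases h3 with ⟨h3, h4⟩ | ⟨s, h3, h4⟩
      · exact ⟨(.bwd, b), by simp [h3], h4⟩
      · refine ⟨s, ?_, h4⟩
        cases l with
        | nil => simp at h3
        | cons y l => simpa [List.getLast?_cons_cons] using h3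

theorem root_bidir (a b r : V) (t : St V) : ¬ MWalk.RootAt ⟨a, (.bidir, b) :: t⟩ r := by
  rintro ⟨l, rr, h, h1, h2, h3⟩
  have : ((.bidir, b) : EKind × V) ∈ l ++ rr := by rw [← h]; simp
  rcases List.mem_append.1 this with h' | h'
  · simpa using h1 _ h'
  · simpa using h2 _ h'

theorem root_fwd (a b r : V) (t : St V) :
    MWalk.RootAt ⟨a, (.fwd, b) :: t⟩ r ↔ (∀ s ∈ t, s.1 = EKind.fwd) ∧ a = r := by
  constructor
  · rintro ⟨l, rr, h, h1, h2, h3⟩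
    cases l with
    | nil =>
      simp at h
      refine ⟨fun s hs => h2 s (by rw [← h]; exact List.mem_cons_of_mem _ hs), ?_⟩
      simpa using h3
    | cons x l =>
      simp at h
      have := h1 x (by simp)
      rw [← h.1] at this; simp at this
  · rintro ⟨h, rfl⟩
    refine ⟨[], (.fwd, b) :: t, by simp, by simp, ?_, .inl ⟨rfl, rfl⟩⟩
    intro s hs
    rcases List.mem_cons.1 hs with rfl | hs
    · rfl
    · exact h s hs

open Classical in
theorem W_eq [Fintype V] (β Λ : V → V → ℝ) (S : V → ℝ) (a : V) (t : St V) :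
    W β Λ S a t = (if MWalk.IsTrek ⟨a, t⟩ then MWalk.weightFrom β Λ a t else 0) +
      ∑ r, (if MWalk.RootAt ⟨a, t⟩ r then MWalk.weightFrom β Λ a t else 0) * S r := by
  induction t generalizing a with
  | nil => simp [trek_nil, root_nil, W, MWalk.weightFrom]
  | cons s t ih =>
    obtain ⟨k, b⟩ := s
    cases k with
    | fwd =>
      simp only [trek_fwd, root_fwd, W, MWalk.weightFrom, if_false, zero_add]
      by_cases h : ∀ s ∈ t, s.1 = EKind.fwd
      · simp only [weight_fwd β Λ b t h]
        simp only [eq_true h, true_and]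
        simp [mul_comm]
      · simp [-Prod.forall, h, fw_zero β b t h]
    | bwd =>
      simp only [trek_bwd, root_bwd, W, MWalk.weightFrom, ih, mul_add, Finset.mul_sum]
      congr 1
      · simp
      · refine Finset.sum_congr rfl fun r _ => ?_
        split_ifs <;> ring
    | bidir =>
      simp only [trek_bidir, root_bidir, W, MWalk.weightFrom, if_false, zero_mul,
        Finset.sum_const_zero, add_zero]
      by_cases h : ∀ s ∈ t, s.1 = EKind.fwd
      · rw [if_pos h, weight_fwd β Λ b t h]
      · rw [if_neg h, fw_zero β b t h, mul_zero]

theorem valid_of_weight {G : MixedGraph V} {β Λ : V → V → ℝ}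
    (hβ : ∀ a b, β a b ≠ 0 → G.dir a b) (hΛ : ∀ a b, Λ a b ≠ 0 → G.bi a b)
    (a : V) (t : St V) (h : MWalk.weightFrom β Λ a t ≠ 0) : MWalk.Valid G a t := by
  induction t generalizing a with
  | nil => trivial
  | cons s t ih =>
    obtain ⟨k, b⟩ := s
    cases k <;> simp only [MWalk.weightFrom, ne_eq, mul_eq_zero, not_or] at h
    · exact ⟨hβ _ _ h.1, ih b h.2⟩
    · exact ⟨hβ _ _ h.1, ih b h.2⟩
    · exact ⟨hΛ _ _ h.1, ih b h.2⟩

theorem root_dconn {w : MWalk V} {r : V} (h : w.RootAt r) (hne : w.tail ≠ []) :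
    w.IsDConnWalk := by
  obtain ⟨l, rr, h, h1, h2, _⟩ := h
  exact ⟨hne, l, rr, h, h1, h2⟩

open Classical in
theorem finsum_walk (s : Set (MWalk V)) (j : V) (hs : ∀ w ∈ s, w.head = j) (f : MWalk V → ℝ) :
    ∑ᶠ w ∈ s, f w = ∑ᶠ t : St V, if (⟨j, t⟩ : MWalk V) ∈ s then f ⟨j, t⟩ else 0 := by
  have hi : Function.Injective (fun t : St V => (⟨j, t⟩ : MWalk V)) := by
    intro a b h; simpa using h
  have := finsum_mem_range (f := fun w => if w ∈ s then f w else 0) hi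
  rw [← this]
  refine finsum_congr fun w => ?_
  rw [finsum_eq_if, finsum_eq_if]
  by_cases hw : w ∈ s
  · have : w ∈ Set.range (fun t : St V => (⟨j, t⟩ : MWalk V)) := by
      refine ⟨w.tail, ?_⟩
      rw [← hs w hw]
    simp only [if_pos hw, if_pos this]
  · simp [hw]

theorem transGen_rd {G : MixedGraph V} {a b : V} (h : Relation.TransGen G.dir a b) :
    G.RDConn a b := by
  induction h using Relation.TransGen.head_induction_on with
  | single h =>
    refine ⟨⟨_, [(.fwd, b)]⟩, ⟨⟨by simp, h, trivial⟩, rfl, rfl⟩, ?_⟩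
    intro s hs; simp at hs; simp [hs]
  | head h _ ih =>
    obtain ⟨⟨x, t⟩, ⟨⟨h1, h2⟩, h3, h4⟩, h5⟩ := ih
    simp only at h3
    subst h3
    refine ⟨⟨_, (.fwd, x) :: t⟩, ⟨⟨by simp, h, h2⟩, rfl, ?_⟩, ?_⟩
    · rw [← h4]; exact lst_cons _ _ _
    · intro s hs
      rcases List.mem_cons.1 hs with rfl | hs
      · rfl
      · exact h5 s hs

open Classical in
theorem rhs_eq [Fintype V] {G : MixedGraph V} {β Λ : V → V → ℝ}
    (hβ : ∀ a b, β a b ≠ 0 → G.dir a b) (hΛ : ∀ a b, Λ a b ≠ 0 → G.bi a b)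
    (S : V → ℝ) {j k : V} (hjk : j ≠ k) :
    (∑ᶠ w ∈ {w : MWalk V | MWalk.IsWalkFrom G w j k ∧ w.IsTrek ∧ w.IsPath}, w.weight β Λ) +
      ∑ r, (∑ᶠ w ∈ {w : MWalk V | MWalk.IsWalkFrom G w j k ∧ w.IsDConnWalk ∧
                w.IsPath ∧ w.RootAt r}, w.weight β Λ) * S r = ∑ᶠ t, phi β Λ S j k t := by
  have hfin : ∀ (s : Set (MWalk V)) (c : ℝ), (∀ w ∈ s, w.IsPath) → (Function.support (fun t : St V =>
      (if (⟨j, t⟩ : MWalk V) ∈ s then MWalk.weight β Λ ⟨j, t⟩ else 0) * c)).Finite := by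
    intro s c hs
    refine finite_supp j _ fun t ht => ?_
    by_contra h
    apply ht
    have : (⟨j, t⟩ : MWalk V) ∉ s := fun h' => h (hs _ h')
    simp [this]
  rw [finsum_walk _ j (fun w hw => hw.1.2.1)]
  have : ∀ r, _ := fun r => finsum_walk {w : MWalk V | MWalk.IsWalkFrom G w j k ∧ w.IsDConnWalk ∧
                w.IsPath ∧ w.RootAt r} j (fun w hw => hw.1.2.1) (MWalk.weight β Λ)
  simp only [this, finsum_mul]
  rw [← finsum_sum_comm _ _ (fun r _ => hfin _ _ (fun w hw => hw.2.2.1)), ← finsum_add_distrib]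
  · refine finsum_congr fun t => ?_
    unfold phi
    split_ifs with h1 h2 h2
    · rw [W_eq, if_pos h1.2.1]
      congr 1
      refine Finset.sum_congr rfl fun r _ => ?_
      congr 1
      by_cases hr : MWalk.RootAt ⟨j, t⟩ r
      · rw [if_pos hr, if_pos ((fun h => ⟨h1.1, root_dconn h h1.1.1.1, h1.2.2, h⟩) hr)]
        rfl
      · rw [if_neg hr, if_neg (fun h => hr h.2.2.2)]
    · exact absurd ⟨h1.2.2, h1.1.2.2⟩ h2
    · have hne : t ≠ [] := by
        rintro rfl
        exact hjk h2.2
      by_cases hw : MWalk.weightFrom β Λ j t = 0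
      · rw [W_eq]
        simp [MWalk.weight, hw]
      have hv := valid_of_weight hβ hΛ j t hw
      have hwf : MWalk.IsWalkFrom G ⟨j, t⟩ j k := ⟨⟨hne, hv⟩, rfl, h2.2⟩
      rw [W_eq, if_neg (fun h => h1 ⟨hwf, h, h2.1⟩)]
      congr 1
      refine Finset.sum_congr rfl fun r _ => ?_
      congr 1
      by_cases hr : MWalk.RootAt ⟨j, t⟩ r
      · rw [if_pos hr, if_pos ((fun h => ⟨hwf, root_dconn h hne, h2.1, h⟩) hr)]
        rfl
      · rw [if_neg hr, if_neg (fun h => hr h.2.2.2)]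
    · rw [zero_add]
      refine Finset.sum_eq_zero fun r _ => ?_
      rw [if_neg, zero_mul]
      intro h
      exact h2 ⟨h.2.2.1, h.1.2.2⟩
  · have := hfin {w : MWalk V | MWalk.IsWalkFrom G w j k ∧ w.IsTrek ∧ w.IsPath} 1
      (fun w hw => hw.2.2)
    simp only [mul_one] at this
    exact this
  · refine finite_supp j _ fun t ht => ?_
    by_contra h
    apply ht
    refine Finset.sum_eq_zero fun r _ => ?_
    rw [if_neg, zero_mul]
    intro h'
    exact h h'.2.2.1

end Wright

open Matrix in
/-- Wright's path analysis: in an acyclic Gaussian linear system, `I - β` is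
invertible and for `j ≠ k` the covariance `Σ j k` equals the total weight of
trek paths from `j` to `k` plus, for each root `r`, the total `β`-weight of
d-connected paths from `j` to `k` with root `r` multiplied by the variance
`Σ r r`. -/
theorem wright_path_analysis (d : ℕ) (G : MixedGraph (Fin d)) (hsymm : G.BiSymm)
    (hacy : G.Acyclic)
    (β Λ : Matrix (Fin d) (Fin d) ℝ)
    (hβc : ∀ a b, β a b ≠ 0 → G.dir a b) (hΛc : ∀ a b, Λ a b ≠ 0 → G.bi a b)
    (hΛsym : Λ.IsSymm) (hpsd : Λ.PosSemidef) :
    IsUnit (1 - β) ∧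
    ∀ Sm : Matrix (Fin d) (Fin d) ℝ, Sm = ((1 - β)⁻¹)ᵀ * Λ * (1 - β)⁻¹ →
      ∀ j k : Fin d, j ≠ k →
        Sm j k =
          (∑ᶠ w ∈ {w : MWalk (Fin d) | MWalk.IsWalkFrom G w j k ∧ w.IsTrek ∧ w.IsPath},
            w.weight (fun a b => β a b) (fun a b => Λ a b)) +
          ∑ r : Fin d,
            (∑ᶠ w ∈ {w : MWalk (Fin d) | MWalk.IsWalkFrom G w j k ∧ w.IsDConnWalk ∧
                w.IsPath ∧ w.RootAt r},
              w.weight (fun a b => β a b) (fun a b => Λ a b)) * Sm r r := by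
  classical
  have hac : ∀ v, ¬ Relation.TransGen G.dir v v := fun v h => hacy v (Wright.transGen_rd h)
  set N : Matrix (Fin d) (Fin d) ℝ := fun a b => Wright.Fw (fun a b => β a b) a b with hN
  set M : Matrix (Fin d) (Fin d) ℝ := fun a b => Wright.Bw (fun a b => β a b) b a with hM
  have hN1 : (1 - β) * N = 1 := by
    ext a b
    rw [sub_mul, one_mul, Matrix.sub_apply, Matrix.mul_apply]
    have := Wright.Fw_rec (β := fun a b => β a b) hβc hac a b
    rw [Matrix.one_apply]
    simp only [hN]
    split_ifs at this ⊢ with h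
    · linarith
    · linarith
  have hM1 : M * (1 - β) = 1 := by
    ext a b
    rw [mul_sub, mul_one, Matrix.sub_apply, Matrix.mul_apply]
    have := Wright.Bw_rec (β := fun a b => β a b) hβc hac b a
    rw [Matrix.one_apply]
    have hs : ∑ x, M a x * β x b = ∑ x, β x b * Wright.Bw (fun a b => β a b) x a :=
      Finset.sum_congr rfl fun x _ => mul_comm _ _
    rw [hs]
    simp only [hM]
    by_cases h : a = b
    · rw [if_pos h]
      rw [if_pos h.symm] at this
      linarith
    · rw [if_neg h]
      rw [if_neg (Ne.symm h)] at this
      linarith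
  have hinv : (1 - β)⁻¹ = N := Matrix.inv_eq_right_inv hN1
  have hinv' : (1 - β)⁻¹ = M := Matrix.inv_eq_left_inv hM1
  refine ⟨IsUnit.of_mul_eq_one _ hN1, ?_⟩
  intro Sm hSm
  have e1 : (1 - β)ᵀ * Sm = Λ * N := by
    rw [hSm, hinv, ← mul_assoc, ← mul_assoc, ← Matrix.transpose_mul, ← hinv, hinv',
      hM1, Matrix.transpose_one, one_mul]
  have e2 : Sm * (1 - β) = Mᵀ * Λ := by
    rw [hSm, mul_assoc, hinv', hM1, mul_one]
  have r1 : ∀ j k, Sm j k = ∑ m, β m j * Sm m k + ∑ m, Λ j m * N m k := by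
    intro j k
    have := congrFun (congrFun e1 j) k
    rw [Matrix.transpose_sub, Matrix.transpose_one, sub_mul, one_mul, Matrix.sub_apply,
      Matrix.mul_apply, Matrix.mul_apply] at this
    simp only [Matrix.transpose_apply] at this
    linarith
  have r2 : ∀ j k, Sm j k = ∑ m, Sm j m * β m k + ∑ m, M m j * Λ m k := by
    intro j k
    have := congrFun (congrFun e2 j) k
    rw [mul_sub, mul_one, Matrix.sub_apply,
      Matrix.mul_apply, Matrix.mul_apply] at this
    simp only [Matrix.transpose_apply] at this
    linarith
  let c : Fin d → ℕ := fun v => (Finset.univ.filter fun u => Relation.TransGen G.dir u v).card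
  have hc : ∀ u v, G.dir u v → c u < c v := by
    intro u v h
    refine Finset.card_lt_card ?_
    rw [Finset.ssubset_iff_of_subset]
    · exact ⟨u, by simpa using .single h, by simpa using hac u⟩
    · intro x hx
      simp only [Finset.mem_filter, Finset.mem_univ, true_and] at hx ⊢
      exact hx.tail h
  have main : ∀ n j k, c j + c k ≤ n → Sm j k =
      ∑ᶠ t, Wright.phi (fun a b => β a b) (fun a b => Λ a b) (fun r => Sm r r) j k t := by
    intro n
    induction n using Nat.strong_induction_on with
    | _ n ih =>
    intro j k hn
    by_cases hjk : j = k
    · subst hjk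
      rw [Wright.phi_diag]
    by_cases h : Relation.TransGen G.dir j k
    · have h' : ¬ Relation.TransGen G.dir k j := fun h' => hac _ (h.trans h')
      rw [Wright.phi_snoc hβc hac hjk h', r2]
      congr 1
      refine Finset.sum_congr rfl fun m _ => ?_
      by_cases hb : β m k = 0
      · simp [hb]
      · have := hc _ _ (hβc _ _ hb)
        rw [ih (c j + c m) (by omega) j m le_rfl]
    · rw [Wright.phi_cons hβc hac hjk h, r1]
      congr 1
      refine Finset.sum_congr rfl fun m _ => ?_
      by_cases hb : β m j = 0
      · simp [hb]
      · have := hc _ _ (hβc _ _ hb)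
        rw [ih (c m + c k) (by omega) m k le_rfl]
  intro j k hjk
  rw [main _ j k le_rfl]
  exact (Wright.rhs_eq hβc hΛc (fun r => Sm r r) hjk).symm
end

section
/- (Marginalization of linear systems) Let G be a directed mixed graph on V = {1, …, d}, let β, Λ ∈ ℝ^{d×d} be compatible with G with Λ symmetric positive semi-definite, and suppose β is principally stable (every principal submatrix of β has spectral radius strictly less than 1). Let Ṽ ⊆ V, and for j, k ∈ Ṽ define β̃_{jk} = Σ_{q=1}^{∞} (finite sum, over right-directed walks from j to k in G of length q all of whose non-endpoints lie outside Ṽ, of the product of β over their edges) and Λ̃_{jk} = Σ_{q=1}^{∞} (finite sum, over treks from j to k in G of length q all of whose non-endpoints lie outside Ṽ, of their weights), both series being absolutely convergent. Then: (a) β̃_{jk} ≠ 0 implies j → k is an edge of marg_Ṽ(G) and Λ̃_{jk} ≠ 0 implies j ↔ k is an edge of marg_Ṽ(G); (b) every principal submatrix of I − β̃ is invertible; (c) the principal submatrix Σ_{Ṽ,Ṽ} of Σ = (I − β)^{-T} Λ (I − β)^{-1} satisfies Σ_{Ṽ,Ṽ} = (I − β̃)^{-T} Λ̃ (I − β̃)^{-1}.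 -/
section Aux
open Matrix

section Norm
attribute [local instance] Matrix.linftyOpNormedRing Matrix.linftyOpNormedAlgebra

theorem aux_entry_le {n : Type*} [Fintype n] [DecidableEq n] (A : Matrix n n ℂ) (i j : n) :
    ‖A i j‖ ≤ ‖A‖ := by
  have h : ‖A i j‖₊ ≤ ‖A‖₊ := by
    rw [Matrix.linfty_opNNNorm_def]
    calc ‖A i j‖₊ ≤ ∑ j, ‖A i j‖₊ :=
          Finset.single_le_sum (f := fun j => ‖A i j‖₊) (fun _ _ => bot_le) (Finset.mem_univ j)
      _ ≤ _ := Finset.le_sup (f := fun i => ∑ j, ‖A i j‖₊) (Finset.mem_univ i)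
  exact_mod_cast h

theorem aux_summable_C {n : Type*} [Fintype n] [DecidableEq n] (A : Matrix n n ℂ)
    (h : spectralRadius ℂ A < 1) (i j : n) : Summable (fun m : ℕ => ‖(A ^ m) i j‖) := by
  obtain ⟨r, hr1, hr2⟩ := ENNReal.lt_iff_exists_nnreal_btwn.1 h
  have hr2' : r < 1 := by exact_mod_cast hr2
  have ht := spectrum.pow_nnnorm_pow_one_div_tendsto_nhds_spectralRadius A
  have hev := ht.eventually_lt_const hr1
  refine Summable.of_norm_bounded_eventually_nat (g := fun m => (r : ℝ) ^ m)
    (summable_geometric_of_lt_one r.2 (by exact_mod_cast hr2')) ?_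
  filter_upwards [hev, Filter.eventually_gt_atTop 0] with m hm hm0
  rw [norm_norm]
  refine (aux_entry_le _ i j).trans ?_
  have hm0' : (m : ℝ) ≠ 0 := by positivity
  have h2 : ((‖A ^ m‖₊ : ENNReal) ^ (1 / (m : ℝ))) ^ (m : ℝ) ≤ (r : ENNReal) ^ (m : ℝ) :=
    ENNReal.rpow_le_rpow hm.le (by positivity)
  rw [← ENNReal.rpow_mul, one_div, inv_mul_cancel₀ hm0', ENNReal.rpow_one,
    ENNReal.rpow_natCast] at h2
  have h3 : ‖A ^ m‖₊ ≤ r ^ m := by exact_mod_cast h2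
  exact_mod_cast h3
end Norm

theorem aux_summable_R {n : Type*} [Fintype n] [DecidableEq n] (A : Matrix n n ℝ)
    (h : spectralRadius ℂ (A.map Complex.ofReal) < 1) : Summable (fun m : ℕ => A ^ m) := by
  refine Pi.summable.2 fun i => Pi.summable.2 fun j => ?_
  have := aux_summable_C _ h i j
  refine Summable.of_norm ?_
  convert this using 2 with m
  have e : (A.map Complex.ofReal) ^ m = (A ^ m).map Complex.ofReal :=
    (map_pow (Complex.ofRealHom.mapMatrix) A m).symm
  rw [e]; simp

theorem aux_inj {n : Type*} [Fintype n] [DecidableEq n] (A : Matrix n n ℝ)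
    (h : Summable (fun m : ℕ => A ^ m)) (x : n → ℝ) (hx : (1 - A) *ᵥ x = 0) : x = 0 := by
  have h1 := h.tsum_pow_mul_one_sub
  have : ((∑' i : ℕ, A ^ i) * (1 - A)) *ᵥ x = 0 := by rw [← mulVec_mulVec, hx, mulVec_zero]
  rwa [h1, one_mulVec] at this

/-- restricted injectivity -/
theorem aux_inj_res {d : ℕ} (β : Matrix (Fin d) (Fin d) ℝ) (U : Finset (Fin d))
    (hstab : spectralRadius ℂ
        ((β.submatrix (fun i : {x // x ∈ U} => (i : Fin d))
            (fun i : {x // x ∈ U} => (i : Fin d))).map Complex.ofReal) < 1)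
    (y : Fin d → ℝ) (hy : ∀ v, v ∉ U → y v = 0) (h : ∀ v ∈ U, ((1 - β) *ᵥ y) v = 0) : y = 0 := by
  have h1 := aux_inj _ (aux_summable_R _ hstab) (fun i => y i) ?_
  · funext v
    by_cases hv : v ∈ U
    · exact congrFun h1 ⟨v, hv⟩
    · exact hy v hv
  · funext i
    have h2 := h i i.2
    rw [sub_mulVec, one_mulVec] at h2 ⊢
    simp only [Pi.sub_apply, Pi.zero_apply, mulVec, dotProduct, submatrix_apply] at h2 ⊢
    rw [← h2]; congr 1
    rw [Finset.sum_coe_sort U (fun x => β i x * y x)]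
    exact Finset.sum_subset (Finset.subset_univ _) (fun v _ hv => by simp [hy v hv])

/-- indicator of the complement times β -/
noncomputable def auxC {d : ℕ} (β : Matrix (Fin d) (Fin d) ℝ) (T : Finset (Fin d)) :
    Matrix (Fin d) (Fin d) ℝ := Matrix.of fun a b => if a ∈ T then 0 else β a b

theorem aux_C_summable {d : ℕ} (β : Matrix (Fin d) (Fin d) ℝ) (T : Finset (Fin d))
    (hstab : spectralRadius ℂ
        ((β.submatrix (fun i : {x // x ∈ Tᶜ} => (i : Fin d))
            (fun i : {x // x ∈ Tᶜ} => (i : Fin d))).map Complex.ofReal) < 1) :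
    Summable (fun m : ℕ => (auxC β T) ^ m) := by
  set S := β.submatrix (fun i : {x // x ∈ Tᶜ} => (i : Fin d))
            (fun i : {x // x ∈ Tᶜ} => (i : Fin d)) with hS
  let F : Matrix (Fin d) {x // x ∈ Tᶜ} ℝ := Matrix.of fun a i => if a = i then 1 else 0
  let H : Matrix {x // x ∈ Tᶜ} (Fin d) ℝ := Matrix.of fun i b => β i b
  have hFH : auxC β T = F * H := by
    ext a b
    simp only [auxC, mul_apply, F, H, of_apply, ite_mul, one_mul, zero_mul]
    rw [Finset.sum_coe_sort Tᶜ (fun x => if a = x then β x b else 0)]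
    rw [Finset.sum_ite_eq]
    simp
  have hHF : H * F = S := by
    ext i j
    simp [mul_apply, F, H, of_apply, S]
  have hs := aux_summable_R S hstab
  rw [← summable_nat_add_iff 1]
  have hpow : ∀ m, (auxC β T) ^ (m + 1) = F * S ^ m * H := by
    intro m
    induction m with
    | zero => simp [hFH]
    | succ m ih => rw [pow_succ, ih, pow_succ S, hFH, ← hHF]; simp only [Matrix.mul_assoc]
  simp_rw [hpow]
  have hc : Continuous (fun X : Matrix {x // x ∈ Tᶜ} {x // x ∈ Tᶜ} ℝ => F * X * H) := by fun_prop
  let φ : Matrix {x // x ∈ Tᶜ} {x // x ∈ Tᶜ} ℝ →+ Matrix (Fin d) (Fin d) ℝ :=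
    { toFun := fun X => F * X * H, map_zero' := by simp, map_add' := by
        intro X Y; simp [Matrix.mul_add, Matrix.add_mul] }
  exact hs.map φ hc

theorem aux_cauchy {f g : ℕ → ℝ} {a b : ℝ} (hf : HasSum f a) (hg : HasSum g b) :
    HasSum (fun n => ∑ kl ∈ Finset.HasAntidiagonal.antidiagonal n, f kl.1 * g kl.2) (a * b) := by
  have hf' := hf.summable.norm
  have hg' := hg.summable.norm
  have h := (summable_norm_sum_mul_antidiagonal_of_summable_norm hf' hg').of_norm
  have e := tsum_mul_tsum_eq_tsum_sum_antidiagonal_of_summable_norm hf' hg'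
  rw [hf.tsum_eq, hg.tsum_eq] at e
  rw [e]; exact h.hasSum

end Aux

section WalkAux
variable {d : ℕ}

/-- prepend a step -/
def auxStep (e : EKind) (f : Fin d → Finset (List (EKind × Fin d))) :
    Finset (List (EKind × Fin d)) :=
  Finset.univ.biUnion fun v => (f v).image fun r => (e, v) :: r

theorem auxStep_mem (e : EKind) (f : Fin d → Finset (List (EKind × Fin d)))
    (t : List (EKind × Fin d)) :
    t ∈ auxStep e f ↔ ∃ v, ∃ r ∈ f v, t = (e, v) :: r := by
  simp only [auxStep, Finset.mem_biUnion, Finset.mem_univ, true_and, Finset.mem_image]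
  constructor
  · rintro ⟨v, r, hr, rfl⟩; exact ⟨v, r, hr, rfl⟩
  · rintro ⟨v, r, hr, rfl⟩; exact ⟨v, r, hr, rfl⟩

theorem auxStep_sum (e : EKind) (f : Fin d → Finset (List (EKind × Fin d)))
    (g : List (EKind × Fin d) → ℝ) :
    ∑ t ∈ auxStep e f, g t = ∑ v, ∑ r ∈ f v, g ((e, v) :: r) := by
  rw [auxStep, Finset.sum_biUnion]
  · refine Finset.sum_congr rfl fun v _ => ?_
    rw [Finset.sum_image]
    intro a _ b _ h
    simpa using h
  · intro v _ u _ hvu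
    rw [Function.onFun, Finset.disjoint_left]
    intro t ht hu
    simp only [Finset.mem_image] at ht hu
    obtain ⟨r, _, rfl⟩ := ht
    obtain ⟨r', _, h⟩ := hu
    simp only [List.cons.injEq, Prod.mk.injEq] at h
    exact hvu h.1.2.symm

/-- forward legs with all but the last vertex outside `T` -/
def auxP (T : Finset (Fin d)) (k : Fin d) : ℕ → Fin d → Finset (List (EKind × Fin d))
  | 0, a => if a = k then {[]} else ∅
  | n + 1, a => if a ∈ T then ∅ else auxStep EKind.fwd (auxP T k n)

/-- treks of length `n + 1` -/
def auxTr (T : Finset (Fin d)) (k : Fin d) : ℕ → Finset (List (EKind × Fin d))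
  | 0 => auxStep EKind.bidir (auxP T k 0)
  | n + 1 => auxStep EKind.bidir (auxP T k (n + 1)) ∪
      auxStep EKind.bwd (fun v => if v ∈ T then ∅ else auxTr T k n)

theorem auxP_mem (T : Finset (Fin d)) (k : Fin d) (n : ℕ) (a : Fin d)
    (t : List (EKind × Fin d)) :
    t ∈ auxP T k n a ↔ t.length = n ∧ (∀ s ∈ t, s.1 = EKind.fwd) ∧
      (t.map Prod.snd).getLastD a = k ∧ ∀ v ∈ (a :: t.map Prod.snd).dropLast, v ∉ T := by
  induction n generalizing a t with
  | zero =>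
    simp only [auxP, List.length_eq_zero_iff]
    constructor
    · intro h
      split_ifs at h with hk
      · simp only [Finset.mem_singleton] at h
        subst h; simp [hk]
      · simp at h
    · rintro ⟨rfl, -, h, -⟩
      simp at h
      simp [h]
  | succ n ih =>
    simp only [auxP]
    constructor
    · intro h
      split_ifs at h with ha
      · simp at h
      · rw [auxStep_mem] at h
        obtain ⟨v, r, hr, rfl⟩ := h
        obtain ⟨h1, h2, h3, h4⟩ := (ih v r).1 hr
        refine ⟨by simp [h1], ?_, ?_, ?_⟩
        · intro s hs
          rcases List.mem_cons.1 hs with rfl | hs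
          · rfl
          · exact h2 s hs
        · simpa only [List.map_cons, List.getLastD_cons] using h3
        · intro u hu
          rw [List.map_cons, List.dropLast_cons_cons, List.mem_cons] at hu
          rcases hu with rfl | hu
          · exact ha
          · exact h4 u hu
    · rintro ⟨h1, h2, h3, h4⟩
      cases t with
      | nil => simp at h1
      | cons s r =>
        obtain ⟨e, v⟩ := s
        have he : e = EKind.fwd := h2 (e, v) (by simp)
        subst he
        rw [List.map_cons, List.dropLast_cons_cons] at h4
        have ha : a ∉ T := h4 a (by simp)
        rw [if_neg ha, auxStep_mem]
        refine ⟨v, r, (ih v r).2 ⟨by simpa using h1, fun s hs => h2 s (by simp [hs]), ?_, ?_⟩, rfl⟩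
        · simpa only [List.map_cons, List.getLastD_cons] using h3
        · exact fun u hu => h4 u (List.mem_cons_of_mem _ hu)

theorem auxTr_mem (T : Finset (Fin d)) (k : Fin d) (n : ℕ) (a : Fin d)
    (t : List (EKind × Fin d)) :
    t ∈ auxTr T k n ↔ t.length = n + 1 ∧ MWalk.IsTrek (⟨a, t⟩ : MWalk (Fin d)) ∧
      (t.map Prod.snd).getLastD a = k ∧ ∀ v ∈ (t.map Prod.snd).dropLast, v ∉ T := by
  have key : ∀ n (a : Fin d) t, t ∈ auxStep EKind.bidir (auxP T k n) →
      t.length = n + 1 ∧ MWalk.IsTrek (⟨a, t⟩ : MWalk (Fin d)) ∧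
      (t.map Prod.snd).getLastD a = k ∧ ∀ v ∈ (t.map Prod.snd).dropLast, v ∉ T := by
    intro n a t h
    rw [auxStep_mem] at h
    obtain ⟨v, r, hr, rfl⟩ := h
    obtain ⟨h1, h2, h3, h4⟩ := (auxP_mem T k n v r).1 hr
    refine ⟨by simp [h1], ⟨[], (EKind.bidir, v), r, rfl, by simp, rfl, h2⟩, ?_, ?_⟩
    · simpa only [List.map_cons, List.getLastD_cons] using h3
    · simpa only [List.map_cons] using h4
  have key2 : ∀ n (a v : Fin d) r, ((EKind.bidir, v) :: r).length = n + 1 →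
      (∀ s ∈ r, s.1 = EKind.fwd) →
      ((((EKind.bidir, v) :: r)).map Prod.snd).getLastD a = k →
      (∀ u ∈ (((EKind.bidir, v) :: r).map Prod.snd).dropLast, u ∉ T) →
      (EKind.bidir, v) :: r ∈ auxStep EKind.bidir (auxP T k n) := by
    intro n a v r h1 h2 h3 h4
    rw [auxStep_mem]
    refine ⟨v, r, (auxP_mem T k n v r).2 ⟨by simpa using h1, h2, ?_, ?_⟩, rfl⟩
    · simpa only [List.map_cons, List.getLastD_cons] using h3
    · simpa only [List.map_cons] using h4
  induction n generalizing a t with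
  | zero =>
    constructor
    · exact key 0 a t
    · rintro ⟨h1, ⟨l, b, r, ht, hl, hb, hr⟩, h3, h4⟩
      dsimp only at ht
      subst ht
      obtain ⟨e, v⟩ := b
      dsimp only at hb
      subst hb
      have : l = [] := by
        rw [← List.length_eq_zero_iff]; simp at h1; omega
      subst this
      exact key2 0 a v r h1 hr h3 h4
  | succ n ih =>
    simp only [auxTr, Finset.mem_union]
    constructor
    · rintro (h | h)
      · exact key (n + 1) a t h
      · rw [auxStep_mem] at h
        obtain ⟨v, r, hr, rfl⟩ := h
        split_ifs at hr with hv
        · simp at hr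
        obtain ⟨h1, ⟨l, b, r', ht, hl, hb, hr'⟩, h3, h4⟩ := (ih v r).1 hr
        dsimp only at ht
        refine ⟨by simp [h1], ⟨(EKind.bwd, v) :: l, b, r', by simp [ht], ?_, hb, hr'⟩, ?_, ?_⟩
        · intro s hs
          rcases List.mem_cons.1 hs with rfl | hs
          · rfl
          · exact hl s hs
        · simpa only [List.map_cons, List.getLastD_cons] using h3
        · intro u hu
          cases r with
          | nil => simp at h1
          | cons s r =>
            rw [List.map_cons, List.map_cons, List.dropLast_cons_cons, List.mem_cons] at hu
            rcases hu with rfl | hu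
            · exact hv
            · exact h4 u hu
    · rintro ⟨h1, ⟨l, b, r, ht, hl, hb, hr⟩, h3, h4⟩
      dsimp only at ht
      subst ht
      cases l with
      | nil =>
        left
        obtain ⟨e, v⟩ := b
        dsimp only at hb
        subst hb
        exact key2 (n + 1) a v r h1 hr h3 h4
      | cons s l =>
        right
        obtain ⟨e, v⟩ := s
        have he : e = EKind.bwd := hl (e, v) (by simp)
        subst he
        rw [auxStep_mem]
        refine ⟨v, l ++ b :: r, ?_, rfl⟩
        have hne : (l ++ b :: r).map Prod.snd ≠ [] := by simp
        rw [List.cons_append, List.map_cons, List.dropLast_cons_of_ne_nil hne] at h4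
        rw [if_neg (h4 v (by simp))]
        refine (ih v _).2 ⟨by simpa using h1, ⟨l, b, r, rfl, fun s hs => hl s (by simp [hs]), hb, hr⟩, ?_, ?_⟩
        · simpa only [List.cons_append, List.map_cons, List.getLastD_cons] using h3
        · exact fun u hu => h4 u (List.mem_cons_of_mem _ hu)

theorem auxP_sum (β Λ : Matrix (Fin d) (Fin d) ℝ) (T : Finset (Fin d)) (k : Fin d) (n : ℕ)
    (a : Fin d) :
    ∑ t ∈ auxP T k n a, MWalk.weightFrom (fun a b => β a b) (fun a b => Λ a b) a t =
      ((auxC β T) ^ n) a k := by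
  induction n generalizing a with
  | zero =>
    simp only [auxP, pow_zero, Matrix.one_apply]
    split_ifs <;> simp [MWalk.weightFrom]
  | succ n ih =>
    rw [pow_succ', Matrix.mul_apply]
    simp only [auxP]
    split_ifs with ha
    · simp [auxC, ha]
    · rw [auxStep_sum]
      refine Finset.sum_congr rfl fun v _ => ?_
      simp only [MWalk.weightFrom]
      rw [← Finset.mul_sum, ih]
      simp [auxC, ha]

theorem auxR_sum (β Λ : Matrix (Fin d) (Fin d) ℝ) (T : Finset (Fin d)) (k : Fin d) (n : ℕ)
    (a : Fin d) :
    ∑ t ∈ auxStep EKind.fwd (auxP T k n),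
      MWalk.weightFrom (fun a b => β a b) (fun a b => Λ a b) a t =
      (β * (auxC β T) ^ n) a k := by
  rw [auxStep_sum, Matrix.mul_apply]
  refine Finset.sum_congr rfl fun v _ => ?_
  simp only [MWalk.weightFrom]
  rw [← Finset.mul_sum, auxP_sum]

theorem auxB_sum (β Λ : Matrix (Fin d) (Fin d) ℝ) (T : Finset (Fin d)) (k : Fin d) (n : ℕ)
    (a : Fin d) :
    ∑ t ∈ auxStep EKind.bidir (auxP T k n),
      MWalk.weightFrom (fun a b => β a b) (fun a b => Λ a b) a t =
      (Λ * (auxC β T) ^ n) a k := by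
  rw [auxStep_sum, Matrix.mul_apply]
  refine Finset.sum_congr rfl fun v _ => ?_
  simp only [MWalk.weightFrom]
  rw [← Finset.mul_sum, auxP_sum]

theorem auxTr_sum (β Λ : Matrix (Fin d) (Fin d) ℝ) (T : Finset (Fin d)) (k : Fin d) (n : ℕ)
    (a : Fin d) :
    ∑ t ∈ auxTr T k n, MWalk.weightFrom (fun a b => β a b) (fun a b => Λ a b) a t =
      (∑ p ∈ Finset.HasAntidiagonal.antidiagonal n,
        ((auxC β T) ^ p.1).transpose * Λ * (auxC β T) ^ p.2) a k := by
  induction n generalizing a with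
  | zero => simp [auxTr, auxB_sum]
  | succ n ih =>
    rw [auxTr, Finset.sum_union, auxB_sum, Finset.Nat.antidiagonal_succ, Finset.sum_cons,
      Matrix.add_apply]
    · congr 1
      · simp
      · rw [auxStep_sum, Finset.sum_map]
        have : ∀ p : ℕ × ℕ, ((auxC β T) ^ (p.1 + 1)).transpose * Λ * (auxC β T) ^ p.2 =
            (auxC β T).transpose * (((auxC β T) ^ p.1).transpose * Λ * (auxC β T) ^ p.2) := by
          intro p
          rw [pow_succ, Matrix.transpose_mul]; simp only [Matrix.mul_assoc]
        simp only [Function.Embedding.prodMap, Function.Embedding.coeFn_mk, Prod.map,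
          Function.Embedding.refl_apply, Nat.succ_eq_add_one, this]
        rw [← Finset.mul_sum, Matrix.mul_apply]
        refine Finset.sum_congr rfl fun v _ => ?_
        rw [← ih]
        simp only [MWalk.weightFrom, Matrix.transpose_apply]
        split_ifs with hv
        · simp [auxC, hv]
        · rw [← Finset.mul_sum]; simp [auxC, hv]
    · rw [Finset.disjoint_left]
      intro t h1 h2
      rw [auxStep_mem] at h1 h2
      obtain ⟨v, r, _, rfl⟩ := h1
      obtain ⟨v', r', _, h⟩ := h2
      simp at h

theorem aux_valid (G : MixedGraph (Fin d)) (β Λ : Matrix (Fin d) (Fin d) ℝ)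
    (hβc : ∀ a b, β a b ≠ 0 → G.dir a b) (hΛc : ∀ a b, Λ a b ≠ 0 → G.bi a b)
    (a : Fin d) (t : List (EKind × Fin d))
    (h : MWalk.weightFrom (fun a b => β a b) (fun a b => Λ a b) a t ≠ 0) :
    MWalk.Valid G a t := by
  induction t generalizing a with
  | nil => trivial
  | cons s r ih =>
    obtain ⟨e, v⟩ := s
    simp only [MWalk.weightFrom] at h
    refine ⟨?_, ih v (right_ne_zero_of_mul h)⟩
    have := left_ne_zero_of_mul h
    cases e
    · exact hβc _ _ this
    · exact hβc _ _ this
    · exact hΛc _ _ this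

theorem aux_finsum (G : MixedGraph (Fin d)) (β Λ : Matrix (Fin d) (Fin d) ℝ)
    (hβc : ∀ a b, β a b ≠ 0 → G.dir a b) (hΛc : ∀ a b, Λ a b ≠ 0 → G.bi a b)
    (j k : Fin d) (q : ℕ) (T : Finset (Fin d)) (Q : MWalk (Fin d) → Prop)
    (F : Finset (List (EKind × Fin d)))
    (hF : ∀ t, t ∈ F ↔ t.length = q + 1 ∧ Q ⟨j, t⟩ ∧
      (t.map Prod.snd).getLastD j = k ∧ ∀ v ∈ (t.map Prod.snd).dropLast, v ∉ T) :
    (∑ᶠ w ∈ {w : MWalk (Fin d) | MWalk.IsWalkFrom G w j k ∧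
              Q w ∧ w.length = q + 1 ∧ ∀ v ∈ w.interior, v ∉ (T : Set (Fin d))},
            w.weight (fun a b => β a b) (fun a b => Λ a b)) =
      ∑ t ∈ F, MWalk.weightFrom (fun a b => β a b) (fun a b => Λ a b) j t := by
  have hinj : Set.InjOn (fun t => (⟨j, t⟩ : MWalk (Fin d))) (F : Set (List (EKind × Fin d))) := by
    intro a _ b _ h
    simpa using h
  have e := finsum_mem_image (f := fun w : MWalk (Fin d) =>
    w.weight (fun a b => β a b) (fun a b => Λ a b)) hinj
  rw [finsum_mem_coe_finset] at e
  have e2 : ∑ t ∈ F, MWalk.weightFrom (fun a b => β a b) (fun a b => Λ a b) j t =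
    ∑ t ∈ F, MWalk.weight (fun a b => β a b) (fun a b => Λ a b) ⟨j, t⟩ := rfl
  rw [e2, ← e]
  refine finsum_mem_inter_support_eq _ _ _ ?_
  ext w
  obtain ⟨a, t⟩ := w
  simp only [Set.mem_inter_iff, Set.mem_ofPred_eq, Function.mem_support, Set.mem_image,
    SetLike.mem_coe, hF, MWalk.weight]
  refine and_congr_left fun hw => ?_
  have hv := aux_valid G β Λ hβc hΛc a t hw
  constructor
  · rintro ⟨⟨_, h2, h3⟩, h4, h5, h6⟩
    dsimp only at h2
    subst h2
    exact ⟨t, ⟨h5, h4, h3, h6⟩, rfl⟩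
  · rintro ⟨t', ⟨h1, h2, h3, h4⟩, h⟩
    simp only [MWalk.mk.injEq] at h
    obtain ⟨rfl, rfl⟩ := h
    exact ⟨⟨⟨by intro h; dsimp only at h; subst h; simp at h1, hv⟩, rfl, h3⟩, h2, h1, h4⟩

theorem auxR_mem (T : Finset (Fin d)) (j k : Fin d) (n : ℕ) (t : List (EKind × Fin d)) :
    t ∈ auxStep EKind.fwd (auxP T k n) ↔ t.length = n + 1 ∧
      MWalk.IsRightDirected (⟨j, t⟩ : MWalk (Fin d)) ∧
      (t.map Prod.snd).getLastD j = k ∧ ∀ v ∈ (t.map Prod.snd).dropLast, v ∉ T := by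
  rw [auxStep_mem]
  constructor
  · rintro ⟨v, r, hr, rfl⟩
    obtain ⟨h1, h2, h3, h4⟩ := (auxP_mem T k n v r).1 hr
    refine ⟨by simp [h1], ?_, ?_, ?_⟩
    · intro s hs
      rcases List.mem_cons.1 hs with rfl | hs
      · rfl
      · exact h2 s hs
    · simpa only [List.map_cons, List.getLastD_cons] using h3
    · simpa only [List.map_cons] using h4
  · rintro ⟨h1, h2, h3, h4⟩
    cases t with
    | nil => simp at h1
    | cons s r =>
      obtain ⟨e, v⟩ := s
      have he : e = EKind.fwd := h2 (e, v) (by simp)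
      subst he
      refine ⟨v, r, (auxP_mem T k n v r).2 ⟨by simpa using h1,
        fun s hs => h2 s (List.mem_cons_of_mem _ hs), ?_, ?_⟩, rfl⟩
      · simpa only [List.map_cons, List.getLastD_cons] using h3
      · simpa only [List.map_cons] using h4

end WalkAux

section MainAux
open Matrix

theorem aux_R_hasSum {d : ℕ} (β C : Matrix (Fin d) (Fin d) ℝ)
    (hC : Summable (fun m : ℕ => C ^ m)) (j k : Fin d) :
    HasSum (fun q => (β * C ^ q) j k) ((β * ∑' m : ℕ, C ^ m) j k) := by
  have h := hC.hasSum.mul_left β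
  exact Pi.hasSum.1 (Pi.hasSum.1 h j) k

theorem aux_Tr_hasSum {d : ℕ} (Λ C : Matrix (Fin d) (Fin d) ℝ)
    (hC : Summable (fun m : ℕ => C ^ m)) (j k : Fin d) :
    HasSum (fun q => (∑ p ∈ Finset.HasAntidiagonal.antidiagonal q,
        (C ^ p.1)ᵀ * Λ * C ^ p.2 : Matrix (Fin d) (Fin d) ℝ) j k)
      (((∑' m : ℕ, C ^ m)ᵀ * Λ * ∑' m : ℕ, C ^ m : Matrix (Fin d) (Fin d) ℝ) j k) := by
  have hent : ∀ a b, HasSum (fun m => (C ^ m) a b) ((∑' m : ℕ, C ^ m) a b) := fun a b =>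
    Pi.hasSum.1 (Pi.hasSum.1 hC.hasSum a) b
  set W := ∑' m : ℕ, C ^ m
  have h : HasSum (fun q => ∑ u, ∑ v, Λ v u * ∑ p ∈ Finset.HasAntidiagonal.antidiagonal q,
      (C ^ p.1) v j * (C ^ p.2) u k) (∑ u, ∑ v, Λ v u * (W v j * W u k)) :=
    hasSum_sum fun u _ => hasSum_sum fun v _ =>
      (aux_cauchy (hent v j) (hent u k)).mul_left (Λ v u)
  convert h using 1
  · funext q
    rw [Matrix.sum_apply]
    simp only [Finset.mul_sum, Matrix.mul_apply, Finset.sum_mul, Matrix.transpose_apply]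
    rw [Finset.sum_comm]
    refine Finset.sum_congr rfl fun u _ => ?_
    rw [Finset.sum_comm]
    refine Finset.sum_congr rfl fun v _ => Finset.sum_congr rfl fun p _ => ?_
    ring
  · simp only [Matrix.mul_apply, Finset.sum_mul, Matrix.transpose_apply]
    refine Finset.sum_congr rfl fun u _ => Finset.sum_congr rfl fun v _ => ?_
    ring

theorem aux_main {d : ℕ} (β Λ : Matrix (Fin d) (Fin d) ℝ)
    (hstab : ∀ S : Finset (Fin d),
      spectralRadius ℂ
        ((β.submatrix (fun i : {x // x ∈ S} => (i : Fin d))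
            (fun i : {x // x ∈ S} => (i : Fin d))).map Complex.ofReal) < 1)
    (T : Finset (Fin d))
    (βt Λt : Matrix {x // x ∈ T} {x // x ∈ T} ℝ)
    (hβt : ∀ j k : {x // x ∈ T}, βt j k = (β * ∑' m : ℕ, (auxC β T) ^ m) j k)
    (hΛt : ∀ j k : {x // x ∈ T},
      Λt j k = ((∑' m : ℕ, (auxC β T) ^ m)ᵀ * Λ * ∑' m : ℕ, (auxC β T) ^ m :
        Matrix (Fin d) (Fin d) ℝ) j k) :
    (∀ S : Finset {x // x ∈ T},
      IsUnit ((1 - βt).submatrix (fun i : {y // y ∈ S} => (i : {x // x ∈ T}))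
        (fun i : {y // y ∈ S} => (i : {x // x ∈ T})))) ∧
    ((((1 - β)⁻¹)ᵀ * Λ * (1 - β)⁻¹).submatrix (fun i : {x // x ∈ T} => (i : Fin d))
          (fun i : {x // x ∈ T} => (i : Fin d)) =
        ((1 - βt)⁻¹)ᵀ * Λt * (1 - βt)⁻¹) := by
  have hW := (aux_C_summable β T (hstab _)).one_sub_mul_tsum_pow
  set W := ∑' m : ℕ, (auxC β T) ^ m
  let E : Matrix (Fin d) {x // x ∈ T} ℝ := Matrix.of fun a i => if a = i then 1 else 0
  have hmulE : ∀ {m : Type} (M : Matrix m (Fin d) ℝ), M * E = M.submatrix id (fun i : {x // x ∈ T} => (i : Fin d)) := by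
    intro m M
    ext a b
    simp [mul_apply, E]
  have hEmul : ∀ {m : Type} (M : Matrix (Fin d) m ℝ), Eᵀ * M = M.submatrix (fun i : {x // x ∈ T} => (i : Fin d)) id := by
    intro m M
    ext a b
    simp [mul_apply, E]
  have hW2 : W = 1 + auxC β T * W := by
    rw [sub_mul, one_mul] at hW
    rw [← hW]; abel
  have hWe : ∀ a b, W a b = (1 : Matrix (Fin d) (Fin d) ℝ) a b + if a ∈ T then 0 else (β * W) a b := by
    intro a b
    conv_lhs => rw [hW2]
    rw [Matrix.add_apply]; congr 1
    simp only [mul_apply, auxC, of_apply]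
    split_ifs <;> simp
  set N := W * E with hN
  have hKN : (1 - β) * N = E * (1 - βt) := by
    rw [hN, ← Matrix.mul_assoc, sub_mul, one_mul, hmulE]
    ext a k
    rw [submatrix_apply, id, Matrix.sub_apply, hWe]
    simp only [mul_apply (M := E), E, of_apply]
    by_cases ha : a ∈ T
    · rw [Finset.sum_eq_single (⟨a, ha⟩ : {x // x ∈ T})]
      · simp [ha, hβt, one_apply, Subtype.ext_iff]
      · intro b _ hb
        rw [if_neg, zero_mul]
        rintro rfl
        exact hb rfl
      · simp
    · have hak : a ≠ k := by rintro rfl; exact ha k.2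
      rw [Finset.sum_eq_zero]
      · simp [ha, one_apply, hak]
      · intro b _
        rw [if_neg, zero_mul]
        rintro rfl
        exact ha b.2
  have hEN : ∀ j k : {x // x ∈ T}, N j k = (1 : Matrix {x // x ∈ T} {x // x ∈ T} ℝ) j k := by
    intro j k
    rw [hN, hmulE, submatrix_apply, id, hWe]
    rw [if_pos j.2, add_zero, one_apply, one_apply]
    simp only [Subtype.ext_iff]
  have hΛN : Λt = Nᵀ * Λ * N := by
    rw [hN, transpose_mul]
    have : Eᵀ * Wᵀ * Λ * (W * E) = (Eᵀ * (Wᵀ * Λ * W)) * E := by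
      simp only [Matrix.mul_assoc]
    rw [this, hEmul, hmulE]
    ext j k
    exact hΛt j k
  have hunit : ∀ S : Finset {x // x ∈ T},
      IsUnit ((1 - βt).submatrix (fun i : {y // y ∈ S} => (i : {x // x ∈ T}))
        (fun i : {y // y ∈ S} => (i : {x // x ∈ T}))) := by
    intro S
    rw [← mulVec_injective_iff_isUnit]
    rw [← coe_mulVecLin, ← LinearMap.ker_eq_bot, LinearMap.ker_eq_bot']
    intro x hx
    rw [mulVecLin_apply] at hx
    let z : {x // x ∈ T} → ℝ := fun i => if h : i ∈ S then x ⟨i, h⟩ else 0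
    have hz : ∀ i ∈ S, ((1 - βt) *ᵥ z) i = 0 := by
      intro i hi
      refine Eq.trans ?_ (congrFun hx ⟨i, hi⟩)
      simp only [mulVec, dotProduct, submatrix_apply]
      rw [← Finset.sum_subset (Finset.subset_univ S), ← Finset.sum_coe_sort S]
      · refine Finset.sum_congr rfl fun v _ => ?_
        simp [z]
      · intro v _ hv
        simp [z, hv]
    have hKy : (1 - β) *ᵥ (N *ᵥ z) = E *ᵥ ((1 - βt) *ᵥ z) := by
      rw [mulVec_mulVec, hKN, mulVec_mulVec]
    have hyT : ∀ i : {x // x ∈ T}, (N *ᵥ z) i = z i := by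
      intro i
      conv_rhs => rw [← one_mulVec z]
      simp only [mulVec, dotProduct, hEN]
    have hy : N *ᵥ z = 0 := by
      let U : Finset (Fin d) := Finset.univ.filter fun v => ∀ h : v ∈ T, (⟨v, h⟩ : {x // x ∈ T}) ∈ S
      refine aux_inj_res β U (hstab U) _ ?_ ?_
      · intro v hv
        simp only [U, Finset.mem_filter, Finset.mem_univ, true_and, not_forall] at hv
        obtain ⟨h1, h2⟩ := hv
        have := hyT ⟨v, h1⟩
        rw [this]
        simp [z, h2]
      · intro v hv
        simp only [U, Finset.mem_filter, Finset.mem_univ, true_and] at hv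
        rw [hKy]
        refine Finset.sum_eq_zero fun i _ => ?_
        simp only [E, of_apply]
        split_ifs with hvi
        · subst hvi
          rw [hz i (hv i.2), mul_zero]
        · simp
    funext i
    have h1 := hyT i.1
    rw [hy] at h1
    simp [z] at h1
    exact h1.symm
  refine ⟨hunit, ?_⟩
  have hK : IsUnit (1 - β) := by
    rw [← mulVec_injective_iff_isUnit]
    rw [← coe_mulVecLin, ← LinearMap.ker_eq_bot, LinearMap.ker_eq_bot']
    intro x hx
    rw [mulVecLin_apply] at hx
    exact aux_inj_res β Finset.univ (hstab _) x (by simp) (fun v _ => by rw [hx]; rfl)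
  have hKt : IsUnit (1 - βt) := by
    rw [← mulVec_injective_iff_isUnit]
    rw [← coe_mulVecLin, ← LinearMap.ker_eq_bot, LinearMap.ker_eq_bot']
    intro x hx
    rw [mulVecLin_apply] at hx
    have h1 := mulVec_injective_iff_isUnit.2 (hunit Finset.univ)
    have h2 : (fun i : {y // y ∈ (Finset.univ : Finset {x // x ∈ T})} => x i) = 0 := by
      apply h1
      rw [mulVec_zero]
      funext i
      refine Eq.trans ?_ (congrFun hx i)
      simp only [mulVec, dotProduct, submatrix_apply]
      rw [Finset.sum_coe_sort Finset.univ (fun v => (1 - βt) i v * x v)]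
    funext i
    exact congrFun h2 ⟨i, Finset.mem_univ i⟩
  have hKd := (isUnit_iff_isUnit_det _).1 hK
  have hKtd := (isUnit_iff_isUnit_det _).1 hKt
  have hfin : (1 - β)⁻¹ * E = N * (1 - βt)⁻¹ := by
    have : N = (1 - β)⁻¹ * (E * (1 - βt)) := by
      rw [← hKN, ← Matrix.mul_assoc, nonsing_inv_mul _ hKd, Matrix.one_mul]
    rw [this, Matrix.mul_assoc, Matrix.mul_assoc, mul_nonsing_inv _ hKtd, Matrix.mul_one]
  have hfinT := congrArg Matrix.transpose hfin
  rw [transpose_mul, transpose_mul] at hfinT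
  have e1 : (((1 - β)⁻¹)ᵀ * Λ * (1 - β)⁻¹).submatrix (fun i : {x // x ∈ T} => (i : Fin d))
          (fun i : {x // x ∈ T} => (i : Fin d)) = (Eᵀ * ((1 - β)⁻¹)ᵀ) * Λ * ((1 - β)⁻¹ * E) := by
    have : (Eᵀ * ((1 - β)⁻¹)ᵀ) * Λ * ((1 - β)⁻¹ * E) = (Eᵀ * (((1 - β)⁻¹)ᵀ * Λ * (1 - β)⁻¹)) * E := by
      simp only [Matrix.mul_assoc]
    rw [this, hEmul, hmulE]
    rfl
  rw [e1, hfinT, hfin, hΛN]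
  simp only [Matrix.mul_assoc]

end MainAux

open Matrix in
/-- Marginalization of a principally stable Gaussian linear system: the
marginal parameters `βt`, `Λt` (given by the absolutely convergent series of
weights of right-directed walks, resp. treks, whose non-endpoints avoid `T`)
are compatible with the marginal graph, every principal submatrix of `I - βt`
is invertible, and the principal submatrix of `Σ` on `T` equals
`(I - βt)⁻ᵀ Λt (I - βt)⁻¹`. -/
theorem marginalization_of_linear_systems (d : ℕ) (G : MixedGraph (Fin d))
    (hsymm : G.BiSymm)
    (β Λ : Matrix (Fin d) (Fin d) ℝ)
    (hβc : ∀ a b, β a b ≠ 0 → G.dir a b) (hΛc : ∀ a b, Λ a b ≠ 0 → G.bi a b)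
    (hΛsym : Λ.IsSymm) (hpsd : Λ.PosSemidef)
    (hstab : ∀ S : Finset (Fin d),
      spectralRadius ℂ
        ((β.submatrix (fun i : {x // x ∈ S} => (i : Fin d))
            (fun i : {x // x ∈ S} => (i : Fin d))).map Complex.ofReal) < 1)
    (T : Finset (Fin d))
    (βt Λt : Matrix {x // x ∈ T} {x // x ∈ T} ℝ)
    (hβt : ∀ j k : {x // x ∈ T},
      HasSum
        (fun q : ℕ =>
          ∑ᶠ w ∈ {w : MWalk (Fin d) | MWalk.IsWalkFrom G w (j : Fin d) (k : Fin d) ∧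
              w.IsRightDirected ∧ w.length = q + 1 ∧
              ∀ v ∈ w.interior, v ∉ (T : Set (Fin d))},
            w.weight (fun a b => β a b) (fun a b => Λ a b))
        (βt j k) ∧
      Summable fun q : ℕ =>
        |∑ᶠ w ∈ {w : MWalk (Fin d) | MWalk.IsWalkFrom G w (j : Fin d) (k : Fin d) ∧
            w.IsRightDirected ∧ w.length = q + 1 ∧
            ∀ v ∈ w.interior, v ∉ (T : Set (Fin d))},
          w.weight (fun a b => β a b) (fun a b => Λ a b)|)
    (hΛt : ∀ j k : {x // x ∈ T},
      HasSum
        (fun q : ℕ =>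
          ∑ᶠ w ∈ {w : MWalk (Fin d) | MWalk.IsWalkFrom G w (j : Fin d) (k : Fin d) ∧
              w.IsTrek ∧ w.length = q + 1 ∧
              ∀ v ∈ w.interior, v ∉ (T : Set (Fin d))},
            w.weight (fun a b => β a b) (fun a b => Λ a b))
        (Λt j k) ∧
      Summable fun q : ℕ =>
        |∑ᶠ w ∈ {w : MWalk (Fin d) | MWalk.IsWalkFrom G w (j : Fin d) (k : Fin d) ∧
            w.IsTrek ∧ w.length = q + 1 ∧
            ∀ v ∈ w.interior, v ∉ (T : Set (Fin d))},
          w.weight (fun a b => β a b) (fun a b => Λ a b)|) :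
    (∀ j k : {x // x ∈ T}, βt j k ≠ 0 →
      (G.marg (T : Set (Fin d))).dir (j : Fin d) (k : Fin d)) ∧
    (∀ j k : {x // x ∈ T}, Λt j k ≠ 0 →
      (G.marg (T : Set (Fin d))).bi (j : Fin d) (k : Fin d)) ∧
    (∀ S : Finset {x // x ∈ T},
      IsUnit ((1 - βt).submatrix (fun i : {y // y ∈ S} => (i : {x // x ∈ T}))
        (fun i : {y // y ∈ S} => (i : {x // x ∈ T})))) ∧
    (∀ Sm : Matrix (Fin d) (Fin d) ℝ, Sm = ((1 - β)⁻¹)ᵀ * Λ * (1 - β)⁻¹ →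
      Sm.submatrix (fun i : {x // x ∈ T} => (i : Fin d))
          (fun i : {x // x ∈ T} => (i : Fin d)) =
        ((1 - βt)⁻¹)ᵀ * Λt * (1 - βt)⁻¹) := by
  have hCs := aux_C_summable β T (hstab _)
  have hmain := aux_main β Λ hstab T βt Λt (fun j k => by
    refine (hβt j k).1.unique ?_
    have h := aux_R_hasSum β _ hCs j k
    convert h using 1
    funext q
    rw [aux_finsum G β Λ hβc hΛc j k q T MWalk.IsRightDirected _ (auxR_mem T j k q), auxR_sum])
    (fun j k => by
    refine (hΛt j k).1.unique ?_
    have h := aux_Tr_hasSum Λ _ hCs j k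
    convert h using 1
    funext q
    rw [aux_finsum G β Λ hβc hΛc j k q T MWalk.IsTrek _ (auxTr_mem T k q j), auxTr_sum])
  refine ⟨?_, ?_, hmain.1, ?_⟩
  · intro j k hjk
    refine ⟨j.2, k.2, ?_⟩
    by_contra hcon
    apply hjk
    refine (hβt j k).1.unique ?_
    convert hasSum_zero with q
    by_contra hne
    obtain ⟨w, hw, -⟩ := exists_ne_zero_of_finsum_mem_ne_zero hne
    exact hcon ⟨w, hw.1, hw.2.1, hw.2.2.2⟩
  · intro j k hjk
    refine ⟨j.2, k.2, ?_⟩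
    by_contra hcon
    apply hjk
    refine (hΛt j k).1.unique ?_
    convert hasSum_zero with q
    by_contra hne
    obtain ⟨w, hw, -⟩ := exists_ne_zero_of_finsum_mem_ne_zero hne
    exact hcon ⟨w, hw.1, hw.2.1, hw.2.2.2⟩
  · rintro Sm rfl
    exact hmain.2
end

section
/- Let G be a canonical directed mixed graph on V = {1, …, d}, and let β, Λ ∈ ℝ^{d×d} be compatible with G, with I − β invertible and Λ symmetric positive definite, and set Σ = (I − β)^{-T} Λ (I − β)^{-1}. If j ≠ k and there is no collider-connected walk from j to k in G, then (Σ^{-1})_{jk} = 0, i.e., ((I − β) Λ^{-1} (I − β)^T)_{jk} = 0. -/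
theorem cc_cons {V : Type*} (a b : V) (s : EKind × V) (l : List (EKind × V))
    (hl : (MWalk.mk b l).IsColliderConnected) (hs : MWalk.arrowAtEnd s.1 = true)
    (hh : ∀ t ∈ l.head?, MWalk.arrowAtStart t.1 = true) :
    (MWalk.mk a (s :: l)).IsColliderConnected := by
  intro i hi
  cases i with
  | zero =>
    cases l with
    | nil => simp at hi
    | cons t r => exact ⟨s, t, by simp, by simp, hs, hh t (by simp)⟩
  | succ i =>
    obtain ⟨x, y, h1, h2, h3, h4⟩ := hl i (by simpa using hi)
    exact ⟨x, y, by simpa using h1, by simpa using h2, h3, h4⟩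

theorem exists_tail {V : Type*} (G : MixedGraph V) (a b k : V)
    (h : Relation.ReflTransGen G.bi a b) (hk : k = b ∨ G.dir k b) :
    ∃ l, MWalk.Valid G a l ∧ (MWalk.mk a l).last = k ∧ (MWalk.mk a l).IsColliderConnected ∧
      ∀ t ∈ l.head?, MWalk.arrowAtStart t.1 = true := by
  induction h using Relation.ReflTransGen.head_induction_on with
  | refl =>
    rcases hk with rfl | hk
    · exact ⟨[], trivial, rfl, fun i hi => by simp at hi, by simp⟩
    · exact ⟨[(EKind.bwd, k)], ⟨hk, trivial⟩, rfl, fun i hi => by simp at hi,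
        by simp [MWalk.arrowAtStart]⟩
  | @head x c hac _ ih =>
    obtain ⟨l, h1, h2, h3, h4⟩ := ih
    refine ⟨(EKind.bidir, c) :: l, ⟨hac, h1⟩, ?_, cc_cons _ c _ _ h3 rfl h4, ?_⟩
    · simpa [MWalk.last, List.getLast?_cons] using h2
    · simp [MWalk.arrowAtStart]

theorem exists_cc {V : Type*} (G : MixedGraph V) (j a b k : V) (hjk : j ≠ k)
    (hj : j = a ∨ G.dir j a)
    (h : Relation.ReflTransGen G.bi a b) (hk : k = b ∨ G.dir k b) :
    ∃ w : MWalk V, MWalk.IsWalkFrom G w j k ∧ w.IsColliderConnected := by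
  obtain ⟨l, h1, h2, h3, h4⟩ := exists_tail G a b k h hk
  rcases hj with rfl | hj
  · refine ⟨⟨j, l⟩, ⟨⟨?_, h1⟩, rfl, h2⟩, h3⟩
    rintro rfl
    exact hjk h2
  · refine ⟨⟨j, (EKind.fwd, a) :: l⟩, ⟨⟨by simp, hj, h1⟩, rfl, ?_⟩, cc_cons _ a _ _ h3 rfl h4⟩
    simpa [MWalk.last, List.getLast?_cons] using h2

theorem inv_reach {d : ℕ} (G : MixedGraph (Fin d)) (hsymm : G.BiSymm)
    (L : Matrix (Fin d) (Fin d) ℝ) (hc : ∀ a b, L a b ≠ 0 → G.bi a b)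
    (hu : IsUnit L.det) (a b : Fin d) (h : L⁻¹ a b ≠ 0) :
    Relation.ReflTransGen G.bi a b := by
  classical
  by_contra hab
  let P : Matrix (Fin d) (Fin d) ℝ :=
    Matrix.diagonal fun c => if Relation.ReflTransGen G.bi a c then 1 else 0
  have hcomm : L * P = P * L := by
    ext x y
    simp only [P, Matrix.mul_diagonal, Matrix.diagonal_mul]
    by_cases hxy : L x y = 0
    · simp [hxy]
    · have e := hc x y hxy
      have : Relation.ReflTransGen G.bi a x ↔ Relation.ReflTransGen G.bi a y :=
        ⟨fun h => h.tail e, fun h => h.tail (hsymm _ _ e)⟩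
      simp [this]
  have h2 : P * L⁻¹ = L⁻¹ * P := by
    calc P * L⁻¹ = L⁻¹ * (L * P) * L⁻¹ := by
          rw [← Matrix.mul_assoc, Matrix.nonsing_inv_mul _ hu, Matrix.one_mul]
      _ = L⁻¹ * P := by
          rw [hcomm, Matrix.mul_assoc, Matrix.mul_assoc, Matrix.mul_nonsing_inv _ hu,
            Matrix.mul_one]
  have h3 := congrFun (congrFun h2 a) b
  simp [P, Matrix.mul_diagonal, Matrix.diagonal_mul, hab, Relation.ReflTransGen.refl] at h3
  exact h h3

open Matrix in
/-- If `j ≠ k` are not connected by a collider-connected walk in a canonical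
graph, then the `(j,k)` entry of the inverse covariance matrix
`Σ⁻¹ = (I - β) Λ⁻¹ (I - β)ᵀ` of the Gaussian linear system vanishes. -/
theorem no_colliderconn_zero_precision (d : ℕ) (G : MixedGraph (Fin d))
    (hsymm : G.BiSymm) (hcan : G.Canonical)
    (β Λ : Matrix (Fin d) (Fin d) ℝ)
    (hβc : ∀ a b, β a b ≠ 0 → G.dir a b) (hΛc : ∀ a b, Λ a b ≠ 0 → G.bi a b)
    (hinv : IsUnit (1 - β)) (hΛsym : Λ.IsSymm) (hpd : Λ.PosDef)
    (j k : Fin d) (hjk : j ≠ k)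
    (hncc : ¬ ∃ w : MWalk (Fin d), MWalk.IsWalkFrom G w j k ∧ w.IsColliderConnected) :
    (∀ Sm : Matrix (Fin d) (Fin d) ℝ, Sm = ((1 - β)⁻¹)ᵀ * Λ * (1 - β)⁻¹ →
      Sm⁻¹ j k = 0) ∧
    (((1 - β) * Λ⁻¹ * (1 - β)ᵀ : Matrix (Fin d) (Fin d) ℝ)) j k = 0 := by
  have hu : IsUnit Λ.det := (Matrix.isUnit_iff_isUnit_det _).1 hpd.isUnit
  have hdet : IsUnit (1 - β).det := (Matrix.isUnit_iff_isUnit_det _).1 hinv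
  have key : (((1 - β) * Λ⁻¹ * (1 - β)ᵀ : Matrix (Fin d) (Fin d) ℝ)) j k = 0 := by
    have one : ∀ x y, (1 - β) x y ≠ 0 → x = y ∨ G.dir x y := by
      intro x y h
      by_cases hxy : x = y
      · exact Or.inl hxy
      · right
        apply hβc
        simpa [Matrix.sub_apply, Matrix.one_apply, hxy] using h
    rw [Matrix.mul_apply]
    refine Finset.sum_eq_zero fun b _ => ?_
    rw [Matrix.mul_apply, Finset.sum_mul]
    refine Finset.sum_eq_zero fun a _ => ?_
    by_contra hne
    have h1 := left_ne_zero_of_mul hne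
    have h2 := right_ne_zero_of_mul hne
    exact hncc (exists_cc G j a b k hjk (one _ _ (left_ne_zero_of_mul h1))
      (inv_reach G hsymm Λ hΛc hu a b (right_ne_zero_of_mul h1)) (one _ _ h2))
  refine ⟨?_, key⟩
  rintro Sm rfl
  rw [Matrix.mul_inv_rev, Matrix.mul_inv_rev, Matrix.transpose_nonsing_inv,
    Matrix.nonsing_inv_nonsing_inv _ hdet, Matrix.nonsing_inv_nonsing_inv _ (by
      rwa [Matrix.det_transpose]), ← Matrix.mul_assoc]
  exact key
end

section
/- (Global Markov property of Gaussian linear systems) Let G be a canonical directed mixed graph on V = {1, …, d}, and let β, Λ ∈ ℝ^{d×d} be compatible with G, with I − β invertible and Λ symmetric positive definite, and set Σ = (I − β)^{-T} Λ (I − β)^{-1}. Let J, K, L ⊆ V be pairwise disjoint and suppose that for every j ∈ J and k ∈ K, every walk from j to k in G is blocked by L (i.e., not J mconn K | L). Then for every j ∈ J and k ∈ K, writing S = {j, k} ∪ L, the principal submatrix Σ_{S,S} is invertible and ((Σ_{S,S})^{-1})_{jk} = 0; equivalently, the Gaussian vector V ∼ N(0, Σ) satisfies the conditional independence V_J ⫫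 V_K | V_L. -/
namespace GMarkov

open Matrix MWalk

variable {V : Type*}

/-- Nonempty open walk (as a list of steps) from `a` to `k`. -/
def OpenTo (G : MixedGraph V) (L : Set V) (k a : V) (s : EKind × V)
    (rest : List (EKind × V)) : Prop :=
  Valid G a (s :: rest) ∧ (⟨a, s :: rest⟩ : MWalk V).last = k ∧
    ¬ (⟨a, s :: rest⟩ : MWalk V).Blocked L

def CoY (G : MixedGraph V) (L : Set V) (k a : V) : Prop :=
  ∃ s rest, OpenTo G L k a s rest ∧ arrowAtStart s.1 = true

def CoZ (G : MixedGraph V) (L : Set V) (k a : V) : Prop :=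
  a ∉ L ∧ (a = k ∨ ∃ s rest, OpenTo G L k a s rest ∧ s.1 = EKind.fwd)

lemma openTo_single (G : MixedGraph V) (L : Set V) (a k : V) (e : EKind)
    (h : Valid G a [(e, k)]) : OpenTo G L k a (e, k) [] := by
  refine ⟨h, rfl, ?_⟩
  rintro ⟨i, v, hi, -⟩
  simp at hi

lemma openTo_cons (G : MixedGraph V) (L : Set V) (a b k : V) (e : EKind)
    (h : Valid G a [(e, b)]) (t : EKind × V) (rest : List (EKind × V))
    (ho : OpenTo G L k b t rest)
    (hc : b ∈ L ↔ (arrowAtEnd e = true ∧ arrowAtStart t.1 = true)) :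
    OpenTo G L k a (e, b) (t :: rest) := by
  obtain ⟨h1, h2, h3⟩ := ho
  refine ⟨⟨h.1, h1⟩, ?_, ?_⟩
  · rw [← h2]; simp [MWalk.last, List.getLast?_cons]
  · rintro ⟨i, v, hi, hv, hb⟩
    rcases i with _ | i
    · have : v = b := by simpa using hv.symm
      subst this
      simp only [ColliderAt] at hb
      simp at hb
      rcases hb with ⟨h5, h6⟩ | ⟨h5, h6⟩
      · exact h6 (hc.mpr h5)
      · obtain ⟨h7, h8⟩ := hc.mp h6
        simp [h5 h7] at h8
    · apply h3
      refine ⟨i, v, ?_, ?_, ?_⟩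
      · simpa using hi
      · simpa using hv
      · simpa [ColliderAt] using hb

/-- The block linear map. -/
def M [Fintype V] [DecidableEq V] (A Λ : Matrix V V ℝ) (L : Finset V) :
    ((V → ℝ) × (V → ℝ)) →ₗ[ℝ] ((V → ℝ) × (V → ℝ)) where
  toFun p := (fun a => if a ∈ L then (Aᵀ *ᵥ p.2) a - (Λ *ᵥ p.1) a else (A *ᵥ p.1) a,
    fun b => if b ∈ L then p.2 b else (Aᵀ *ᵥ p.2) b - (Λ *ᵥ p.1) b)
  map_add' p q := by
    ext a <;> by_cases h : a ∈ L <;> simp [h, mulVec_add] <;> ring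
  map_smul' c p := by
    ext a <;> by_cases h : a ∈ L <;> simp [h, mulVec_smul] <;> ring

/-- From `M p = (e, 0)` extract the equations. -/
lemma M_eqs [Fintype V] [DecidableEq V] (A Λ : Matrix V V ℝ) (L : Finset V)
    (p : (V → ℝ) × (V → ℝ)) (e : V → ℝ) (he : ∀ a ∈ L, e a = 0)
    (h : M A Λ L p = (e, 0)) :
    (∀ a, a ∉ L → (A *ᵥ p.1) a = e a) ∧ (∀ a ∈ L, p.2 a = 0) ∧ Aᵀ *ᵥ p.2 = Λ *ᵥ p.1 := by
  have h1 : ∀ a, (M A Λ L p).1 a = e a := fun a => by rw [h]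
  have h2 : ∀ a, (M A Λ L p).2 a = 0 := fun a => by rw [h]; rfl
  simp only [M, LinearMap.coe_mk, AddHom.coe_mk] at h1 h2
  refine ⟨fun a ha => by simpa [ha] using h1 a, fun a ha => by simpa [ha] using h2 a, ?_⟩
  ext a
  by_cases ha : a ∈ L
  · have := h1 a
    rw [if_pos ha, he a ha] at this; linarith
  · have := h2 a
    rw [if_neg ha] at this; linarith

lemma energy [Fintype V] (A Λ : Matrix V V ℝ) (y z : V → ℝ)
    (h : Aᵀ *ᵥ z = Λ *ᵥ y) : z ⬝ᵥ (A *ᵥ y) = y ⬝ᵥ (Λ *ᵥ y) := by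
  rw [← h, dotProduct_mulVec, dotProduct_comm y, mulVec_transpose]

lemma M_inj [Fintype V] [DecidableEq V] (A Λ : Matrix V V ℝ) (L : Finset V)
    (hA : IsUnit A) (hpd : Λ.PosDef) : Function.Injective (M A Λ L) := by
  rw [injective_iff_map_eq_zero]
  intro p hp
  obtain ⟨h1, h2, h3⟩ := M_eqs A Λ L p 0 (fun _ _ => rfl) hp
  have hE := energy A Λ p.1 p.2 h3
  have h0 : p.2 ⬝ᵥ (A *ᵥ p.1) = 0 := by
    apply Finset.sum_eq_zero
    intro a _
    by_cases ha : a ∈ L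
    · simp [h2 a ha]
    · simp [h1 a ha]
  have hy : p.1 = 0 := by
    by_contra hne
    have := hpd.dotProduct_mulVec_pos hne
    simp at this
    linarith
  have hz : p.2 = 0 := by
    rw [hy, mulVec_zero] at h3
    have hT : IsUnit Aᵀ := by rwa [isUnit_transpose]
    have := mulVec_injective_of_isUnit hT
    apply this
    rw [h3, mulVec_zero]
  exact Prod.ext hy hz

/-- The coordinate subspace of states that cannot reach `k`. -/
def P (G : MixedGraph V) (L : Set V) (k : V) : Submodule ℝ ((V → ℝ) × (V → ℝ)) where
  carrier := {p | (∀ a, CoY G L k a → p.1 a = 0) ∧ ∀ b, (b ∈ L ∨ CoZ G L k b) → p.2 b = 0}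
  add_mem' := by
    rintro p q ⟨h1, h2⟩ ⟨h3, h4⟩
    exact ⟨fun a ha => by simp [h1 a ha, h3 a ha], fun a ha => by simp [h2 a ha, h4 a ha]⟩
  zero_mem' := by simp
  smul_mem' := by
    rintro c p ⟨h1, h2⟩
    exact ⟨fun a ha => by simp [h1 a ha], fun a ha => by simp [h2 a ha]⟩

lemma M_maps [Fintype V] [DecidableEq V] (G : MixedGraph V) (hsymm : G.BiSymm)
    (β Λ : Matrix V V ℝ)
    (hβc : ∀ a b, β a b ≠ 0 → G.dir a b) (hΛc : ∀ a b, Λ a b ≠ 0 → G.bi a b)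
    (L : Finset V) (k : V) (p : (V → ℝ) × (V → ℝ)) (hp : p ∈ P G (L : Set V) k) :
    M (1 - β) Λ L p ∈ P G (L : Set V) k := by
  obtain ⟨hy, hz⟩ := hp
  have key : ∀ b : V, (b ∈ L ∧ CoY G L k b) ∨ (CoZ G L k b) →
      ((1 - β)ᵀ *ᵥ p.2) b - (Λ *ᵥ p.1) b = 0 := by
    intro b hb
    have hb0 : p.2 b = 0 := hz b (hb.imp (fun h => h.1) id)
    have e1 : (βᵀ *ᵥ p.2) b = 0 := by
      apply Finset.sum_eq_zero
      intro a _
      by_contra hne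
      have hd := hβc a b (fun h => hne (by simp [h]))
      have hza : p.2 a ≠ 0 := fun h => hne (by simp [h])
      apply hza
      by_cases haL : a ∈ L
      · exact hz a (Or.inl haL)
      refine hz a (Or.inr ⟨by simpa using haL, Or.inr ?_⟩)
      rcases hb with ⟨hbL, s, rest, ho, hs⟩ | ⟨hbL, rfl | ⟨s, rest, ho, hs⟩⟩
      · exact ⟨(.fwd, b), s :: rest, openTo_cons G L a b k .fwd ⟨hd, trivial⟩ s rest ho
          (by simp [arrowAtEnd, hs, hbL]), rfl⟩
      · exact ⟨(.fwd, b), [], openTo_single G L a b .fwd ⟨hd, trivial⟩, rfl⟩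
      · exact ⟨(.fwd, b), s :: rest, openTo_cons G L a b k .fwd ⟨hd, trivial⟩ s rest ho
          (by simpa [arrowAtStart, hs] using hbL), rfl⟩
    have e2 : (Λ *ᵥ p.1) b = 0 := by
      apply Finset.sum_eq_zero
      intro a _
      by_contra hne
      have hd := hsymm _ _ (hΛc b a (fun h => hne (by simp [h])))
      have hya : p.1 a ≠ 0 := fun h => hne (by simp [h])
      apply hya
      apply hy a
      rcases hb with ⟨hbL, s, rest, ho, hs⟩ | ⟨hbL, rfl | ⟨s, rest, ho, hs⟩⟩
      · exact ⟨(.bidir, b), s :: rest, openTo_cons G L a b k .bidir ⟨hd, trivial⟩ s rest ho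
          (by simp [arrowAtEnd, hs, hbL]), rfl⟩
      · exact ⟨(.bidir, b), [], openTo_single G L a b .bidir ⟨hd, trivial⟩, rfl⟩
      · exact ⟨(.bidir, b), s :: rest, openTo_cons G L a b k .bidir ⟨hd, trivial⟩ s rest ho
          (by simpa [arrowAtStart, hs] using hbL), rfl⟩
    simp [sub_mulVec, e1, e2, hb0]
  refine ⟨?_, ?_⟩
  · intro a ha
    simp only [M, LinearMap.coe_mk, AddHom.coe_mk]
    split_ifs with haL
    · exact key a (Or.inl ⟨haL, ha⟩)
    · have e1 : (β *ᵥ p.1) a = 0 := by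
        apply Finset.sum_eq_zero
        intro b _
        by_contra hne
        have hd := hβc a b (fun h => hne (by simp [h]))
        have hyb : p.1 b ≠ 0 := fun h => hne (by simp [h])
        apply hyb
        apply hy b
        obtain ⟨s, rest, ho, hs⟩ := ha
        exact ⟨(.bwd, a), s :: rest, openTo_cons G L b a k .bwd ⟨hd, trivial⟩ s rest ho
          (by simpa [arrowAtEnd] using haL), rfl⟩
      simp [sub_mulVec, e1, hy a ha]
  · intro b hb
    simp only [M, LinearMap.coe_mk, AddHom.coe_mk]
    split_ifs with hbL
    · exact hz b (Or.inl hbL)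
    · exact key b (Or.inr (hb.resolve_left (by simpa using hbL)))

/-- Solving inside the invariant subspace. -/
lemma exists_sol {W : Type*} [AddCommGroup W] [Module ℝ W] [FiniteDimensional ℝ W]
    (f : W →ₗ[ℝ] W) (hf : Function.Injective f) (Q : Submodule ℝ W)
    (hQ : ∀ x ∈ Q, f x ∈ Q) (e : W) (he : e ∈ Q) : ∃ x ∈ Q, f x = e := by
  have hi : Function.Injective (f.restrict hQ) := by
    intro x y h
    apply Subtype.ext
    apply hf
    exact congrArg Subtype.val h
  obtain ⟨x, hx⟩ := (LinearMap.injective_iff_surjective.mp hi) ⟨e, he⟩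
  exact ⟨x, x.2, congrArg Subtype.val hx⟩

end GMarkov

open Matrix in
/-- The global Markov property of Gaussian linear systems: if every walk from
`J` to `K` is blocked by `L`, then for each `j ∈ J`, `k ∈ K` the principal
submatrix of `Σ` on `{j, k} ∪ L` is invertible and the `(j,k)` entry of its
inverse vanishes (i.e. `V_J ⫫ V_K | V_L` for the Gaussian vector). -/
theorem gaussian_global_markov (d : ℕ) (G : MixedGraph (Fin d))
    (hsymm : G.BiSymm) (hcan : G.Canonical)
    (β Λ : Matrix (Fin d) (Fin d) ℝ)
    (hβc : ∀ a b, β a b ≠ 0 → G.dir a b) (hΛc : ∀ a b, Λ a b ≠ 0 → G.bi a b)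
    (hinv : IsUnit (1 - β)) (hΛsym : Λ.IsSymm) (hpd : Λ.PosDef)
    (J K L : Finset (Fin d))
    (hJK : Disjoint J K) (hJL : Disjoint J L) (hKL : Disjoint K L)
    (hsep : ∀ j ∈ J, ∀ k ∈ K, ∀ w : MWalk (Fin d),
      MWalk.IsWalkFrom G w j k → w.Blocked (L : Set (Fin d))) :
    ∀ Sm : Matrix (Fin d) (Fin d) ℝ, Sm = ((1 - β)⁻¹)ᵀ * Λ * (1 - β)⁻¹ →
      ∀ j ∈ J, ∀ k ∈ K,
        ∀ St : Matrix {x // x ∈ insert j (insert k L)}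
            {x // x ∈ insert j (insert k L)} ℝ,
          St = Sm.submatrix (fun a : {x // x ∈ insert j (insert k L)} => (a : Fin d))
              (fun a : {x // x ∈ insert j (insert k L)} => (a : Fin d)) →
          IsUnit St ∧
          St⁻¹ ⟨j, Finset.mem_insert_self j (insert k L)⟩
              ⟨k, Finset.mem_insert_of_mem (Finset.mem_insert_self k L)⟩ = 0 := by
  intro Sm hSm j hj k hk St hSt
  have hjL : j ∉ L := Finset.disjoint_left.mp hJL hj
  have hkL : k ∉ L := Finset.disjoint_left.mp hKL hk
  have hjk : j ≠ k := fun h => Finset.disjoint_left.mp hJK hj (h ▸ hk)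
  have hdet : IsUnit (1 - β).det := (Matrix.isUnit_iff_isUnit_det _).mp hinv
  have hSmpd : Sm.PosDef := by
    have hinj : Function.Injective ((1 - β)⁻¹).mulVec :=
      Matrix.mulVec_injective_of_isUnit ((Matrix.isUnit_nonsing_inv_iff).mpr hinv)
    have := hpd.conjTranspose_mul_mul_same hinj
    rw [hSm]
    simpa [Matrix.conjTranspose_eq_transpose_of_trivial] using this
  have hStpd : St.PosDef := by
    rw [hSt]
    exact hSmpd.submatrix Subtype.val_injective
  have hStU : IsUnit St := hStpd.isUnit
  refine ⟨hStU, ?_⟩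
  have hnY : ¬ GMarkov.CoY G (L : Set (Fin d)) k j := by
    rintro ⟨s, rest, ⟨h1, h2, h3⟩, -⟩
    exact h3 (hsep j hj k hk ⟨j, s :: rest⟩ ⟨⟨by simp, h1⟩, rfl, h2⟩)
  have heP : ((Pi.single j 1, 0) : (Fin d → ℝ) × (Fin d → ℝ)) ∈
      GMarkov.P G (L : Set (Fin d)) k := by
    refine ⟨fun a ha => ?_, fun _ _ => rfl⟩
    have : a ≠ j := fun h => hnY (h ▸ ha)
    simp [this]
  obtain ⟨p, hpP, hpe⟩ := GMarkov.exists_sol _ (GMarkov.M_inj (1 - β) Λ L hinv hpd)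
    (GMarkov.P G (L : Set (Fin d)) k)
    (fun x hx => GMarkov.M_maps G hsymm β Λ hβc hΛc L k x hx) _ heP
  obtain ⟨h1, h2, h3⟩ := GMarkov.M_eqs (1 - β) Λ L p (Pi.single j 1)
    (fun a ha => by
      have : a ≠ j := fun h => hjL (h ▸ ha)
      simp [this]) hpe
  have hzk : p.2 k = 0 := hpP.2 k (Or.inr ⟨by simpa using hkL, Or.inl rfl⟩)
  set u := (1 - β) *ᵥ p.1 with hu
  have hSu : Sm *ᵥ u = p.2 := by
    rw [hSm, hu, Matrix.mulVec_mulVec, Matrix.mul_assoc, Matrix.nonsing_inv_mul _ hdet,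
      Matrix.mul_one, ← Matrix.mulVec_mulVec, ← h3, Matrix.mulVec_mulVec,
      ← Matrix.transpose_mul, Matrix.mul_nonsing_inv _ hdet]
    simp
  have hStu : St *ᵥ (fun a => u a) =
      Pi.single ⟨j, Finset.mem_insert_self j (insert k L)⟩ (p.2 j) := by
    ext ⟨a, ha⟩
    have e1 : (St *ᵥ (fun a => u a)) ⟨a, ha⟩ = (Sm *ᵥ u) a := by
      rw [hSt]
      simp only [Matrix.mulVec, dotProduct, Matrix.submatrix_apply]
      rw [Finset.sum_coe_sort (insert j (insert k L)) (fun b => Sm a b * u b)]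
      apply Finset.sum_subset (Finset.subset_univ _)
      intro b _ hb
      simp only [Finset.mem_insert, not_or] at hb
      rw [h1 b hb.2.2]
      simp [hb.1]
    rw [e1, hSu]
    by_cases haj : a = j
    · subst haj; simp
    · rw [Pi.single_eq_of_ne (by simpa using haj)]
      simp only [Finset.mem_insert] at ha
      rcases ha with ha | ha | ha
      · exact absurd ha haj
      · rw [ha, hzk]
      · exact h2 a ha
  have hdetS : IsUnit St.det := (Matrix.isUnit_iff_isUnit_det _).mp hStU
  have huS : (fun a : {x // x ∈ insert j (insert k L)} => u a) = St⁻¹ *ᵥ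
      Pi.single ⟨j, Finset.mem_insert_self j (insert k L)⟩ (p.2 j) := by
    rw [← hStu, Matrix.mulVec_mulVec, Matrix.nonsing_inv_mul _ hdetS, Matrix.one_mulVec]
  have huj : u j = 1 := by rw [h1 j hjL]; simp
  have huk : u k = 0 := by rw [h1 k hkL]; simp [hjk.symm]
  have hj' := congrFun huS ⟨j, Finset.mem_insert_self j (insert k L)⟩
  have hk' := congrFun huS ⟨k, Finset.mem_insert_of_mem (Finset.mem_insert_self k L)⟩
  simp only [Matrix.mulVec_single, Pi.smul_apply, Matrix.col_apply, huj, huk] at hj' hk'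
  have hsymS : (St⁻¹)ᵀ = St⁻¹ := by
    have := hStpd.isHermitian.inv.eq
    simpa [Matrix.conjTranspose_eq_transpose_of_trivial] using this
  rw [← hsymS, Matrix.transpose_apply]
  have hz : p.2 j ≠ 0 := by
    intro h
    rw [h] at hj'
    simp at hj'
  simpa [hz] using hk'.symm
end

section
/- Let G be a canonical acyclic directed mixed graph on V = {1, …, d}, and let β, Λ ∈ ℝ^{d×d} be compatible with G with Λ symmetric positive definite; set Σ = (I − β)^{-T} Λ (I − β)^{-1}. Let {j}, {k}, L ⊂ V be pairwise disjoint, Ṽ = {j, k} ∪ L, G̃ = marg_Ṽ(G), Σ̃ = Σ_{Ṽ,Ṽ}, and γ = −((Σ̃^{-1})_{jk}) / ((Σ̃^{-1})_{kk}), and define β̃_{jk} as the (finite) sum, over right-directed walks from j to k in G all of whose non-endpoints lie outside Ṽ, of the product of β over their edges. Suppose: (1) every path from j to k in G̃ that is not blocked by L equals the single directed edge j → k; and (2) there is no right-directed walk in G̃ from k to any member of L. Then γ = β̃_{jk}. -/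
section Helpers

open Matrix

variable {V : Type*}

theorem aux_wf [Finite V] (G : MixedGraph V) (hacy : G.Acyclic) :
    WellFounded (fun a b => G.dir b a) := by
  have key : ∀ a b, Relation.TransGen G.dir a b → G.RDConn a b := by
    intro a b h
    induction h using Relation.TransGen.head_induction_on with
    | single h =>
      rename_i a
      exact ⟨⟨a, [(EKind.fwd, b)]⟩, by
        simp [MWalk.IsWalkFrom, MWalk.IsWalk, MWalk.Valid, MWalk.last, MWalk.IsRightDirected, h]⟩
    | head h1 h2 ih =>
      rename_i a c
      obtain ⟨⟨x, l⟩, ⟨⟨hne, hv⟩, hh, hl⟩, hr⟩ := ih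
      simp only at hh
      subst hh
      refine ⟨⟨a, (EKind.fwd, x) :: l⟩, ⟨⟨by simp, ?_⟩, rfl, ?_⟩, ?_⟩
      · exact ⟨h1, hv⟩
      · simpa only [MWalk.last, List.map_cons, List.getLastD_cons] using hl
      · intro s hs
        rcases List.mem_cons.1 hs with rfl | hs
        · rfl
        · exact hr s hs
  have : IsTrans V (fun a b => Relation.TransGen G.dir b a) := ⟨fun a b c h1 h2 => h2.trans h1⟩
  have : Std.Irrefl (fun a b => Relation.TransGen G.dir b a) := ⟨fun a h => hacy a (key a a h)⟩
  have wf := Finite.wellFounded_of_trans_of_irrefl (fun a b => Relation.TransGen G.dir b a)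
  exact Subrelation.wf (fun {a b} h => Relation.TransGen.single h) wf

theorem aux_unit [Fintype V] [DecidableEq V] (r : V → V → Prop)
    (wf : WellFounded (fun a b => r b a)) (M : Matrix V V ℝ) (hM : ∀ a b, M a b ≠ 0 → r a b) :
    IsUnit (1 - M) := by
  rw [Matrix.isUnit_iff_isUnit_det, isUnit_iff_ne_zero]
  intro h0
  obtain ⟨x, hx, h⟩ := Matrix.exists_mulVec_eq_zero_iff.2 h0
  apply hx
  funext v
  induction v using wf.induction with
  | _ v ih =>
    have h' := congrFun h v
    rw [Matrix.sub_mulVec, Matrix.one_mulVec, Pi.sub_apply, Pi.zero_apply, sub_eq_zero] at h'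
    rw [h', Pi.zero_apply]
    refine Finset.sum_eq_zero fun u _ => ?_
    by_cases hu : M v u = 0
    · simp [hu]
    · rw [ih u (hM _ _ hu)]; simp

theorem aux_valid_append (G : MixedGraph V) (l m : List (EKind × V)) : ∀ a,
    MWalk.Valid G a (l ++ m) ↔
      MWalk.Valid G a l ∧ MWalk.Valid G ((l.map Prod.snd).getLastD a) m := by
  induction l with
  | nil => intro a; simp [MWalk.Valid]
  | cons s l ih =>
    intro a
    simp only [List.cons_append, MWalk.Valid, ih, List.map_cons, List.getLastD_cons, and_assoc]

/-- Forward support walks. -/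
theorem aux_fwd [Fintype V] [DecidableEq V] (G : MixedGraph V)
    (wf : WellFounded (fun a b => G.dir b a)) (T : Finset V)
    (β P : Matrix V V ℝ) (hβ : ∀ a b, β a b ≠ 0 → G.dir a b)
    (hP : ∀ v t, P v t = (if v = t then 1 else 0) + (if v ∈ T then 0 else (β * P) v t)) (t : V) :
    ∀ v, P v t ≠ 0 → (∃ l : List (EKind × V), (∀ s ∈ l, s.1 = EKind.fwd) ∧ MWalk.Valid G v l ∧
      (l.map Prod.snd).getLastD v = t ∧ ∀ x ∈ (v :: l.map Prod.snd).dropLast, x ∉ T) ∧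
      (∃ l : List (EKind × V), (∀ s ∈ l, s.1 = EKind.bwd) ∧ MWalk.Valid G t l ∧
      (l.map Prod.snd).getLastD t = v ∧ ∀ x ∈ l.map Prod.snd, x ∉ T) := by
  intro v
  induction v using wf.induction with
  | _ v ih =>
    intro hv
    by_cases hvt : v = t
    · subst hvt
      exact ⟨⟨[], by simp [MWalk.Valid]⟩, ⟨[], by simp [MWalk.Valid]⟩⟩
    rw [hP, if_neg hvt, zero_add] at hv
    by_cases hvT : v ∈ T
    · simp [hvT] at hv
    rw [if_neg hvT, Matrix.mul_apply] at hv
    obtain ⟨x, -, hx⟩ := Finset.exists_ne_zero_of_sum_ne_zero hv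
    have hd := hβ _ _ (left_ne_zero_of_mul hx)
    obtain ⟨⟨l, hl1, hl2, hl3, hl4⟩, ⟨m, hm1, hm2, hm3, hm4⟩⟩ := ih x hd (right_ne_zero_of_mul hx)
    constructor
    · refine ⟨(EKind.fwd, x) :: l, ?_, ⟨hd, hl2⟩, ?_, ?_⟩
      · intro s hs
        rcases List.mem_cons.1 hs with rfl | hs
        · rfl
        · exact hl1 s hs
      · simpa only [List.map_cons, List.getLastD_cons] using hl3
      · intro y hy
        rw [List.map_cons, List.dropLast_cons_of_ne_nil (by simp)] at hy
        rcases List.mem_cons.1 hy with rfl | hy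
        · exact hvT
        · exact hl4 y hy
    · refine ⟨m ++ [(EKind.bwd, v)], ?_, ?_, ?_, ?_⟩
      · intro s hs
        rcases List.mem_append.1 hs with hs | hs
        · exact hm1 s hs
        · simp at hs; rw [hs]
      · rw [aux_valid_append]
        refine ⟨hm2, ?_⟩
        rw [hm3]
        exact ⟨hd, trivial⟩
      · simp
      · intro y hy
        simp only [List.map_append, List.mem_append, List.map_cons, List.map_nil,
          List.mem_singleton] at hy
        rcases hy with hy | rfl
        · exact hm4 y hy
        · exact hvT

theorem aux_mulfin {α : Type*} (s : Set α) (r : ℝ) (f : α → ℝ) (hs : s.Finite) :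
    r * ∑ᶠ a ∈ s, f a = ∑ᶠ a ∈ s, r * f a := by
  rw [finsum_mem_eq_finite_toFinset_sum _ hs, finsum_mem_eq_finite_toFinset_sum _ hs,
    Finset.mul_sum]

/-- The step lists of the walks in the coefficient sum. -/
def auxS (G : MixedGraph V) (T : Finset V) (k v : V) : Set (List (EKind × V)) :=
  {l | l ≠ [] ∧ MWalk.Valid G v l ∧ (l.map Prod.snd).getLastD v = k ∧
    (∀ s ∈ l, s.1 = EKind.fwd) ∧ ∀ x ∈ (l.map Prod.snd).dropLast, x ∉ T}

theorem aux_sum [Fintype V] [DecidableEq V] (G : MixedGraph V)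
    (wf : WellFounded (fun a b => G.dir b a)) (T : Finset V)
    (β P Λ : Matrix V V ℝ) (hβ : ∀ a b, β a b ≠ 0 → G.dir a b)
    (hP : ∀ v t, P v t = (if v = t then 1 else 0) + (if v ∈ T then 0 else (β * P) v t))
    (k : V) (hk : k ∈ T) : ∀ v, (auxS G T k v).Finite ∧
      ∑ᶠ l ∈ auxS G T k v, MWalk.weightFrom (fun a b => β a b) (fun a b => Λ a b) v l
        = (β * P) v k := by
  intro v
  induction v using wf.induction with
  | _ v ih =>
    let S' : V → Set (List (EKind × V)) := fun x =>
      {l | G.dir v x ∧ ((x = k ∧ l = []) ∨ (x ∉ T ∧ l ∈ auxS G T k x))}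
    have hS : auxS G T k v = ⋃ x, (fun l => (EKind.fwd, x) :: l) '' S' x := by
      ext l
      simp only [Set.mem_iUnion, Set.mem_image]
      constructor
      · rintro ⟨h1, h2, h3, h4, h5⟩
        match l, h1, h2, h3, h4, h5 with
        | (e, x) :: l, h1, h2, h3, h4, h5 =>
          have he : e = EKind.fwd := h4 (e, x) (by simp)
          subst he
          refine ⟨x, l, ⟨h2.1, ?_⟩, rfl⟩
          by_cases hl : l = []
          · subst hl
            left
            simpa using h3
          · right
            rw [List.map_cons, List.dropLast_cons_of_ne_nil (by simpa using hl)] at h5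
            refine ⟨h5 x (by simp), hl, h2.2, ?_, fun s hs => h4 s (by simp [hs]),
              fun y hy => h5 y (by simp [hy])⟩
            simpa only [List.map_cons, List.getLastD_cons] using h3
      · rintro ⟨x, l, ⟨hd, h⟩, rfl⟩
        rcases h with ⟨rfl, rfl⟩ | ⟨hx, h1, h2, h3, h4, h5⟩
        · refine ⟨by simp, ⟨hd, trivial⟩, by simp, by simp, by simp⟩
        · refine ⟨by simp, ⟨hd, h2⟩, ?_, ?_, ?_⟩
          · simpa only [List.map_cons, List.getLastD_cons] using h3
          · intro s hs
            rcases List.mem_cons.1 hs with rfl | hs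
            · rfl
            · exact h4 s hs
          · intro y hy
            rw [List.map_cons, List.dropLast_cons_of_ne_nil (by simpa using h1)] at hy
            rcases List.mem_cons.1 hy with rfl | hy
            · exact hx
            · exact h5 y hy
    have hfin : ∀ x, (S' x).Finite := by
      intro x
      by_cases hd : G.dir v x
      · refine ((Set.finite_singleton []).union (ih x hd).1).subset ?_
        rintro l ⟨-, ⟨-, h⟩ | ⟨-, h⟩⟩
        · exact Or.inl h
        · exact Or.inr h
      · refine Set.finite_empty.subset ?_
        rintro l ⟨h, -⟩
        exact hd h
    refine ⟨?_, ?_⟩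
    · rw [hS]
      exact Set.finite_iUnion fun x => (hfin x).image _
    · rw [hS, finsum_mem_iUnion, finsum_eq_sum_of_fintype, Matrix.mul_apply]
      · refine Finset.sum_congr rfl fun x _ => ?_
        rw [finsum_mem_image (fun a _ b _ h => List.tail_eq_of_cons_eq h)]
        have : ∀ l, MWalk.weightFrom (fun a b => β a b) (fun a b => Λ a b) v ((EKind.fwd, x) :: l)
          = β v x * MWalk.weightFrom (fun a b => β a b) (fun a b => Λ a b) x l := fun l => rfl
        simp only [this]
        rw [← aux_mulfin _ _ _ (hfin x)]
        by_cases hd : G.dir v x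
        · congr 1
          rw [hP]
          by_cases hx : x = k
          · have : S' x = {[]} := by
              subst hx; ext l; simp [S', hd, hk]
            rw [this, finsum_mem_singleton]
            simp [hx, hk, MWalk.weightFrom]
          · by_cases hxT : x ∈ T
            · have : S' x = ∅ := by
                ext l; simp [S', hx, hxT]
              rw [this, finsum_mem_empty]
              simp [hx, hxT]
            · have : S' x = auxS G T k x := by
                ext l; simp [S', hd, hx, hxT]
              rw [this, (ih x hd).2]
              simp [hx, hxT]
        · have : β v x = 0 := by
            by_contra h; exact hd (hβ _ _ h)
          simp [this]
      · intro x y hxy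
        refine Set.disjoint_left.2 ?_
        rintro _ ⟨l, -, rfl⟩ ⟨m, -, h⟩
        simp at h
        exact hxy h.1.symm
      · exact fun x => (hfin x).image _

/-- A collider path through `L` is not blocked. -/
theorem aux_notBlocked (L : Set V) (j k c : V) (ys : List V) (κ : EKind) (hκ : κ ≠ EKind.bwd)
    (hnd : (j :: c :: ys).Nodup) (hlast : (c :: ys).getLast (by simp) = k)
    (hT : ∀ x ∈ c :: ys, x = j ∨ x = k ∨ x ∈ L) :
    ¬ (⟨j, (κ, c) :: ys.map (fun x => (EKind.bidir, x))⟩ : MWalk V).Blocked L := by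
  rintro ⟨i, v, hi, hv, h⟩
  simp only [List.length_cons, List.length_map, Nat.add_lt_add_iff_right] at hi
  have hvv : (c :: ys)[i]? = some v := by
    rw [← hv, ← List.getElem?_map]
    simp [Function.comp_def]
  have hmem : v ∈ c :: ys := List.mem_of_getElem? hvv
  rcases h with ⟨-, h⟩ | ⟨h, -⟩
  · rw [List.nodup_cons] at hnd
    rcases hT v hmem with rfl | rfl | hL
    · exact hnd.1 hmem
    · rw [List.getLast_eq_getElem] at hlast
      obtain ⟨hi', hvv⟩ := List.getElem?_eq_some_iff.1 hvv
      have := (hnd.2.getElem_inj_iff).1 (hvv.trans hlast.symm)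
      simp at this
      omega
    · exact h hL
  · apply h
    refine ⟨(if i = 0 then κ else EKind.bidir, v), (EKind.bidir, ys[i]), ?_, ?_, ?_, rfl⟩
    · cases i with
      | zero => simpa using hvv
      | succ i => simpa using hvv
    · simp [hi]
    · by_cases hi0 : i = 0
      · simp only [hi0, if_true]
        cases κ <;> simp_all [MWalk.arrowAtEnd]
      · simp [hi0, MWalk.arrowAtEnd]

theorem aux_support (K : SimpleGraph V) {u v : V} (p : K.Walk u v) :
    p.support = u :: p.support.tail := by
  cases p <;> rfl

theorem aux_walk (K : SimpleGraph V) (G : MixedGraph V) (hK : ∀ a b, K.Adj a b → G.bi a b)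
    {u v : V} (p : K.Walk u v) :
    MWalk.Valid G u (p.support.tail.map (fun x => (EKind.bidir, x))) := by
  induction p with
  | nil => simp [MWalk.Valid]
  | cons h p ih =>
    rw [SimpleGraph.Walk.support_cons, List.tail_cons, aux_support]
    exact ⟨hK _ _ h, ih⟩

theorem aux_comb (K : SimpleGraph V) (G : MixedGraph V) (L : Set V) (j k : V) (hjk : j ≠ k)
    (hK : ∀ a b, K.Adj a b → G.bi a b ∧ (b = j ∨ b = k ∨ b ∈ L))
    (hd : ∀ a b, G.dir a b → (b = j ∨ b = k ∨ b ∈ L))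
    (h1 : ∀ w : MWalk V, MWalk.IsWalkFrom G w j k → w.IsPath → ¬ w.Blocked L →
      w.tail = [(EKind.fwd, k)]) :
    ¬ K.Reachable j k ∧ ∀ c, K.Reachable c k → c ≠ k → ¬ G.dir j c := by
  classical
  have hsupp : ∀ {u v : V} (p : K.Walk u v), ∀ x ∈ p.support.tail, x = j ∨ x = k ∨ x ∈ L := by
    intro u v p
    induction p with
    | nil => simp
    | cons h p ih =>
      intro x hx
      rw [SimpleGraph.Walk.support_cons, List.tail_cons, aux_support] at hx
      rcases List.mem_cons.1 hx with rfl | hx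
      · exact (hK _ _ h).2
      · exact ih x hx
  have hone : ¬ K.Reachable j k := by
    intro hr
    obtain ⟨q, hq⟩ := hr.exists_isPath
    have hs := hsupp q
    have hval := aux_walk K G (fun a b h => (hK a b h).1) q
    have hnd := hq.support_nodup
    cases q with
    | nil => exact hjk rfl
    | cons h p =>
      rename_i c
      have hlast : (c :: p.support.tail).getLast (by simp) = k := by
        simp only [← aux_support]
        exact p.getLast_support
      rw [SimpleGraph.Walk.support_cons, aux_support K p] at hs hval hnd
      simp only [List.tail_cons] at hs hval
      have := h1 ⟨j, (EKind.bidir, c) :: p.support.tail.map (fun x => (EKind.bidir, x))⟩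
        ⟨⟨by simp, hval⟩, rfl, ?_⟩ ?_ (aux_notBlocked L j k c _ _ (by simp) hnd hlast hs)
      · simp at this
      · refine Eq.trans ?_ hlast
        simp [MWalk.last, Function.comp_def, List.getLastD_eq_getLast?,
          List.getLast?_eq_some_getLast]
      · simpa [MWalk.IsPath, MWalk.verts, Function.comp_def] using hnd
  refine ⟨hone, ?_⟩
  intro c hr hck hdir
  obtain ⟨p, hp⟩ := hr.exists_isPath
  have hval := aux_walk K G (fun a b h => (hK a b h).1) p
  have hnd : (j :: c :: p.support.tail).Nodup := by
    rw [← aux_support, List.nodup_cons]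
    exact ⟨fun hj => hone ⟨p.dropUntil j hj⟩, hp.support_nodup⟩
  have hlast : (c :: p.support.tail).getLast (by simp) = k := by
    simp only [← aux_support]
    exact p.getLast_support
  have hs : ∀ x ∈ c :: p.support.tail, x = j ∨ x = k ∨ x ∈ L := by
    intro x hx
    rcases List.mem_cons.1 hx with rfl | hx
    · exact hd _ _ hdir
    · exact hsupp p x hx
  have := h1 ⟨j, (EKind.fwd, c) :: p.support.tail.map (fun x => (EKind.bidir, x))⟩
    ⟨⟨by simp, hdir, hval⟩, rfl, ?_⟩ ?_ (aux_notBlocked L j k c _ _ (by simp) hnd hlast hs)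
  · simp at this
    exact hck this.1
  · refine Eq.trans ?_ hlast
    simp [MWalk.last, Function.comp_def, List.getLastD_eq_getLast?,
      List.getLast?_eq_some_getLast]
  · simpa [MWalk.IsPath, MWalk.verts, Function.comp_def] using hnd

/-- The linear algebra part. -/
theorem aux_linalg {n : Type*} [Fintype n] [DecidableEq n] (A S M : Matrix n n ℝ)
    (hM : M.PosDef) (hA : Aᵀ * S * A = M) (j k : n) (C : Set n) (hkC : k ∈ C) (b : ℝ)
    (hC : ∀ a c, a ∉ C → c ∈ C → M a c = 0)
    (hk : ∀ a, A k a = if a = k then 1 else 0)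
    (hj : ∀ a ∈ C, A j a = if a = k then -b else 0) :
    -(S⁻¹ j k) / (S⁻¹ k k) = b := by
  classical
  have hMu : IsUnit M := hM.isUnit
  have hMdet := (Matrix.isUnit_iff_isUnit_det _).1 hMu
  have hdet : IsUnit (Aᵀ.det * S.det * A.det) := by
    rw [← Matrix.det_mul, ← Matrix.det_mul, hA]; exact hMdet
  have hSdet : IsUnit S.det := isUnit_of_mul_isUnit_right (isUnit_of_mul_isUnit_left hdet)
  have hAdet : IsUnit Aᵀ.det := isUnit_of_mul_isUnit_left (isUnit_of_mul_isUnit_left hdet)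
  let e : n → ℝ := Pi.single k 1
  let y : n → ℝ := M⁻¹ *ᵥ e
  have hMy : M *ᵥ y = e := by
    simp only [y]
    rw [Matrix.mulVec_mulVec, Matrix.mul_nonsing_inv _ hMdet, Matrix.one_mulVec]
  have hquad : ∀ x : n → ℝ, x ≠ 0 → 0 < x ⬝ᵥ (M *ᵥ x) := by
    intro x hx
    simpa using hM.dotProduct_mulVec_pos hx
  have hsym : ∀ a c, M a c = M c a := by
    intro a c
    simpa using hM.isHermitian.apply c a
  -- support
  let y' : n → ℝ := fun a => if a ∈ C then 0 else y a
  have hy' : y' = 0 := by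
    by_contra hne
    have hpos := hquad y' hne
    have : y' ⬝ᵥ (M *ᵥ y') = 0 := by
      refine Finset.sum_eq_zero fun a _ => ?_
      by_cases ha : a ∈ C
      · simp [y', ha]
      · have : (M *ᵥ y') a = (M *ᵥ y) a := by
          refine Finset.sum_congr rfl fun c _ => ?_
          by_cases hc : c ∈ C
          · simp [hC a c ha hc]
          · simp [y', hc]
        rw [this, hMy]
        have hak : a ≠ k := fun h => ha (h ▸ hkC)
        simp [e, hak]
    linarith
  have hysupp : ∀ a, a ∉ C → y a = 0 := by
    intro a ha
    have := congrFun hy' a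
    simpa [y', ha] using this
  have hyk : 0 < y k := by
    have hne : y ≠ 0 := by
      intro h
      rw [h, Matrix.mulVec_zero] at hMy
      have := congrFun hMy k
      simp [e] at this
    have := hquad y hne
    rw [hMy] at this
    simpa [e] using this
  have hAe : Aᵀ *ᵥ e = e := by
    funext a
    simp [e, Matrix.mulVec_single, hk a, Pi.single_apply]
  have hSAy : S *ᵥ (A *ᵥ y) = e := by
    have h3 : Aᵀ *ᵥ (S *ᵥ (A *ᵥ y)) = Aᵀ *ᵥ e := by
      rw [Matrix.mulVec_mulVec, Matrix.mulVec_mulVec, hA, hMy, hAe]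
    exact Matrix.mulVec_injective_iff_isUnit.2 ((Matrix.isUnit_iff_isUnit_det _).2 hAdet) h3
  have hAy : S⁻¹ *ᵥ e = A *ᵥ y := by
    rw [← hSAy, Matrix.mulVec_mulVec, Matrix.nonsing_inv_mul _ hSdet, Matrix.one_mulVec]
  have hcol : ∀ a, S⁻¹ a k = (A *ᵥ y) a := by
    intro a
    rw [← hAy]
    simp [e, Matrix.mulVec_single]
  have hjj : (A *ᵥ y) j = -b * y k := by
    have : ∀ a, A j a * y a = if a = k then -b * y k else 0 := by
      intro a
      by_cases ha : a ∈ C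
      · rw [hj a ha]
        by_cases hak : a = k <;> simp [hak]
      · have hak : a ≠ k := fun h => ha (h ▸ hkC)
        simp [hysupp a ha, hak]
    simp only [Matrix.mulVec, dotProduct, this]
    simp
  have hkk : (A *ᵥ y) k = y k := by
    simp only [Matrix.mulVec, dotProduct, hk]
    simp
  rw [hcol, hcol, hjj, hkk]
  field_simp

end Helpers

open Matrix in
/-- If in the marginal graph on `Ṽ = {j, k} ∪ L` the only possible unblocked
path from `j` to `k` is the directed edge `j → k`, and `L` contains no
descendant of `k` there, then the population regression coefficient
`γ = -(Σ̃⁻¹)_{jk} / (Σ̃⁻¹)_{kk}` equals the marginal edge coefficient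
`β̃_{jk}`. -/
theorem regression_coefficient_marginal_edge (d : ℕ) (G : MixedGraph (Fin d))
    (hsymm : G.BiSymm) (hcan : G.Canonical) (hacy : G.Acyclic)
    (β Λ : Matrix (Fin d) (Fin d) ℝ)
    (hβc : ∀ a b, β a b ≠ 0 → G.dir a b) (hΛc : ∀ a b, Λ a b ≠ 0 → G.bi a b)
    (hΛsym : Λ.IsSymm) (hpd : Λ.PosDef)
    (j k : Fin d) (L : Finset (Fin d))
    (hjk : j ≠ k) (hjL : j ∉ L) (hkL : k ∉ L)
    (h1 : ∀ w : MWalk (Fin d),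
      MWalk.IsWalkFrom (G.marg ((insert j (insert k L) : Finset (Fin d)) : Set (Fin d))) w j k →
      w.IsPath → ¬ w.Blocked (L : Set (Fin d)) → w.tail = [(EKind.fwd, k)])
    (h2 : ¬ ∃ l ∈ L,
      (G.marg ((insert j (insert k L) : Finset (Fin d)) : Set (Fin d))).RDConn k l) :
    ∀ Sm : Matrix (Fin d) (Fin d) ℝ, Sm = ((1 - β)⁻¹)ᵀ * Λ * (1 - β)⁻¹ →
      ∀ St : Matrix {x // x ∈ insert j (insert k L)}
          {x // x ∈ insert j (insert k L)} ℝ,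
        St = Sm.submatrix (fun a : {x // x ∈ insert j (insert k L)} => (a : Fin d))
            (fun a : {x // x ∈ insert j (insert k L)} => (a : Fin d)) →
        -(St⁻¹ ⟨j, Finset.mem_insert_self j (insert k L)⟩
            ⟨k, Finset.mem_insert_of_mem (Finset.mem_insert_self k L)⟩) /
          (St⁻¹ ⟨k, Finset.mem_insert_of_mem (Finset.mem_insert_self k L)⟩
            ⟨k, Finset.mem_insert_of_mem (Finset.mem_insert_self k L)⟩) =
        ∑ᶠ w ∈ {w : MWalk (Fin d) | MWalk.IsWalkFrom G w j k ∧ w.IsRightDirected ∧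
            ∀ v ∈ w.interior, v ∉ ((insert j (insert k L) : Finset (Fin d)) : Set (Fin d))},
          w.weight (fun a b => β a b) (fun a b => Λ a b) := by
  
  intro Sm hSm
  classical
  have wf := aux_wf G hacy
  suffices hmain : ∀ T : Finset (Fin d), T = insert j (insert k L) →
      ∀ (hjT : j ∈ T) (hkT : k ∈ T), ∀ St : Matrix {x // x ∈ T} {x // x ∈ T} ℝ,
        St = Sm.submatrix (fun a : {x // x ∈ T} => (a : Fin d))
            (fun a : {x // x ∈ T} => (a : Fin d)) →
        -(St⁻¹ ⟨j, hjT⟩ ⟨k, hkT⟩) / (St⁻¹ ⟨k, hkT⟩ ⟨k, hkT⟩) =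
        ∑ᶠ w ∈ {w : MWalk (Fin d) | MWalk.IsWalkFrom G w j k ∧ w.IsRightDirected ∧
            ∀ v ∈ w.interior, v ∉ (T : Set (Fin d))},
          w.weight (fun a b => β a b) (fun a b => Λ a b) from
    hmain _ rfl _ _
  intro T hT hjT hkT St hSt
  have hTmem : ∀ x, x ∈ T → x = j ∨ x = k ∨ x ∈ (L : Set (Fin d)) := by
    intro x hx; simpa [hT] using hx
  rw [← hT] at h1 h2
  obtain ⟨N, hN⟩ : ∃ N : Matrix (Fin d) (Fin d) ℝ,
    N = Matrix.of fun a b => if a ∈ T then 0 else β a b := ⟨_, rfl⟩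
  have hNu : IsUnit (1 - N) := by
    refine aux_unit G.dir wf N fun a b h => hβc a b ?_
    intro h0
    simp [hN, h0] at h
  have hβu : IsUnit (1 - β) := aux_unit G.dir wf β hβc
  have hNd := (Matrix.isUnit_iff_isUnit_det _).1 hNu
  have hβd := (Matrix.isUnit_iff_isUnit_det _).1 hβu
  obtain ⟨P, hPd⟩ : ∃ P, P = (1 - N)⁻¹ := ⟨_, rfl⟩
  have hNP : (1 - N) * P = 1 := by rw [hPd, Matrix.mul_nonsing_inv _ hNd]
  have hPN : P * (1 - N) = 1 := by rw [hPd, Matrix.nonsing_inv_mul _ hNd]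
  have hNPe : ∀ v t, (N * P) v t = if v ∈ T then 0 else (β * P) v t := by
    intro v t
    by_cases hv : v ∈ T <;> simp [Matrix.mul_apply, hN, hv]
  have hP : ∀ v t, P v t = (if v = t then 1 else 0) + (if v ∈ T then 0 else (β * P) v t) := by
    intro v t
    have h3 := congrFun (congrFun hNP v) t
    rw [Matrix.sub_mul, Matrix.one_mul, Matrix.sub_apply, hNPe, Matrix.one_apply] at h3
    linarith
  obtain ⟨B, hB⟩ : ∃ B : Matrix (Fin d) (Fin d) ℝ,
    B = Matrix.of fun a b => if a ∈ T then (β * P) a b else 0 := ⟨_, rfl⟩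
  have hβP : (1 - β) * P = 1 - B := by
    rw [Matrix.sub_mul, Matrix.one_mul]
    ext v t
    have h3 := hP v t
    simp only [Matrix.sub_apply, hB, Matrix.of_apply, Matrix.one_apply]
    by_cases hv : v ∈ T
    · simp only [hv, if_true] at h3 ⊢
      linarith
    · simp only [hv, if_false] at h3 ⊢
      linarith
  obtain ⟨R, hR⟩ : ∃ R : Matrix (Fin d) {x // x ∈ T} ℝ,
    R = (1 : Matrix (Fin d) (Fin d) ℝ).submatrix id Subtype.val := ⟨_, rfl⟩
  have hsub : ∀ X : Matrix (Fin d) (Fin d) ℝ,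
      X.submatrix (fun a : {x // x ∈ T} => (a : Fin d)) (fun a : {x // x ∈ T} => (a : Fin d))
        = Rᵀ * X * R := by
    intro X
    ext a b
    simp [hR, Matrix.mul_apply, Matrix.one_apply]
  obtain ⟨A, hA⟩ : ∃ A : Matrix {x // x ∈ T} {x // x ∈ T} ℝ,
    A = 1 - B.submatrix (fun a : {x // x ∈ T} => (a : Fin d))
      (fun a : {x // x ∈ T} => (a : Fin d)) := ⟨_, rfl⟩
  have hRA : R * A = (1 - B) * R := by
    have hRB : R * B.submatrix (fun a : {x // x ∈ T} => (a : Fin d))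
      (fun a : {x // x ∈ T} => (a : Fin d)) = B * R := by
      ext v t
      have h1 : (B * R) v t = B v t := by simp [hR, Matrix.mul_apply, Matrix.one_apply]
      rw [h1, Matrix.mul_apply]
      by_cases hv : v ∈ T
      · rw [Finset.sum_eq_single (⟨v, hv⟩ : {x // x ∈ T})]
        · simp [hR, Matrix.one_apply]
        · intro b _ hb
          have : v ≠ b := fun h => hb (Subtype.ext h.symm)
          simp [hR, Matrix.one_apply, this]
        · simp
      · have hB0 : B v t = 0 := by simp [hB, hv]
        rw [hB0]
        refine Finset.sum_eq_zero fun b _ => ?_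
        have : v ≠ b := fun h => hv (h ▸ b.2)
        simp [hR, Matrix.one_apply, this]
    rw [hA, Matrix.mul_sub, hRB, Matrix.mul_one, Matrix.sub_mul, Matrix.one_mul]
  obtain ⟨M, hM⟩ : ∃ M, M = (P * R)ᵀ * Λ * (P * R) := ⟨_, rfl⟩
  have hASA : Aᵀ * St * A = M := by
    have e1 : Aᵀ * St * A = (R * A)ᵀ * Sm * (R * A) := by
      rw [hSt, hsub, Matrix.transpose_mul]; simp only [Matrix.mul_assoc]
    have e2 : (1 - β)⁻¹ * ((1 - β) * (P * R)) = P * R := by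
      rw [← Matrix.mul_assoc, Matrix.nonsing_inv_mul _ hβd, Matrix.one_mul]
    have e3 := congrArg Matrix.transpose e2
    rw [Matrix.transpose_mul] at e3
    rw [e1, hRA, ← hβP, hSm, hM, Matrix.mul_assoc (1 - β) P R]
    calc _ = (((1 - β) * (P * R))ᵀ * ((1 - β)⁻¹)ᵀ) * Λ * ((1 - β)⁻¹ * ((1 - β) * (P * R))) := by
          simp only [Matrix.mul_assoc]
      _ = _ := by rw [e2, e3]
  have hMpd : M.PosDef := by
    have hinj : Function.Injective (P * R).mulVec := by
      intro x y hxy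
      have h3 := congrArg (fun z => (1 - N) *ᵥ z) hxy
      simp only [Matrix.mulVec_mulVec, ← Matrix.mul_assoc, hNP, Matrix.one_mul] at h3
      funext a
      have h4 := congrFun h3 a
      simpa [hR, Matrix.mulVec, dotProduct, Matrix.one_apply, Subtype.val_inj] using h4
    have := hpd.conjTranspose_mul_mul_same hinj
    rwa [Matrix.conjTranspose_eq_transpose_of_trivial, ← hM] at this
  have hsupp := aux_fwd G wf T β P hβc hP
  have hMe : ∀ a b, M a b = (Pᵀ * Λ * P) a b := by
    intro a b
    have : M = (Pᵀ * Λ * P).submatrix (fun a : {x // x ∈ T} => (a : Fin d))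
        (fun a : {x // x ∈ T} => (a : Fin d)) := by
      rw [hsub, hM, Matrix.transpose_mul]; simp only [Matrix.mul_assoc]
    rw [this]; rfl
  have hbi : ∀ a b : {x // x ∈ T}, M a b ≠ 0 → (G.marg (T : Set (Fin d))).bi a b := by
    intro s t h
    rw [hMe, Matrix.mul_apply] at h
    obtain ⟨b, -, hb⟩ := Finset.exists_ne_zero_of_sum_ne_zero h
    have hb1 := left_ne_zero_of_mul hb
    rw [Matrix.mul_apply] at hb1
    obtain ⟨a, -, ha⟩ := Finset.exists_ne_zero_of_sum_ne_zero hb1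
    have hab := hΛc _ _ (right_ne_zero_of_mul ha)
    obtain ⟨-, ⟨l, hl1, hl2, hl3, hl4⟩⟩ := hsupp s a (left_ne_zero_of_mul ha)
    obtain ⟨⟨r, hr1, hr2, hr3, hr4⟩, -⟩ := hsupp t b (right_ne_zero_of_mul hb)
    refine ⟨s.2, t.2, ⟨s, l ++ (EKind.bidir, b) :: r⟩, ⟨⟨by simp, ?_⟩, rfl, ?_⟩,
      ⟨l, (EKind.bidir, b), r, rfl, hl1, rfl, hr1⟩, ?_⟩
    · rw [aux_valid_append]
      refine ⟨hl2, ?_⟩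
      rw [hl3]
      exact ⟨hab, hr2⟩
    · rw [← hr3]
      simp [MWalk.last, List.getLastD_eq_getLast?, List.getLast?_append, List.getLast?_cons]
    · intro x hx
      simp only [MWalk.interior, List.map_append, List.map_cons] at hx
      rw [List.dropLast_append_of_ne_nil (by simp)] at hx
      rcases List.mem_append.1 hx with hx | hx
      · exact_mod_cast hl4 x hx
      · exact_mod_cast hr4 x hx
  have hdirw : ∀ s ∈ T, ∀ t ∈ T, (β * P) s t ≠ 0 → (G.marg (T : Set (Fin d))).dir s t := by
    intro s hs t ht h
    rw [Matrix.mul_apply] at h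
    obtain ⟨b, -, hb⟩ := Finset.exists_ne_zero_of_sum_ne_zero h
    have hd := hβc _ _ (left_ne_zero_of_mul hb)
    obtain ⟨⟨r, hr1, hr2, hr3, hr4⟩, -⟩ := hsupp t b (right_ne_zero_of_mul hb)
    refine ⟨hs, ht, ⟨s, (EKind.fwd, b) :: r⟩, ⟨⟨by simp, hd, hr2⟩, rfl, ?_⟩, ?_, ?_⟩
    · simpa only [MWalk.last, List.map_cons, List.getLastD_cons] using hr3
    · intro x hx
      rcases List.mem_cons.1 hx with rfl | hx
      · rfl
      · exact hr1 x hx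
    · intro x hx
      exact_mod_cast hr4 x (by simpa [MWalk.interior] using hx)
  let K : SimpleGraph (Fin d) :=
    { Adj := fun a b => a ≠ b ∧ ∃ (ha : a ∈ T) (hb : b ∈ T), M ⟨a, ha⟩ ⟨b, hb⟩ ≠ 0
      symm := ⟨by
        rintro a b ⟨hab, ha, hb, h⟩
        refine ⟨hab.symm, hb, ha, ?_⟩
        have := hMpd.isHermitian.apply ⟨a, ha⟩ ⟨b, hb⟩
        simp only [star_trivial] at this
        rwa [this]⟩
      loopless := ⟨fun a h => h.1 rfl⟩ }
  obtain ⟨hc1, hc2⟩ := aux_comb K (G.marg (T : Set (Fin d))) (L : Set (Fin d)) j k hjk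
    (by
      rintro a b ⟨-, ha, hb, h⟩
      exact ⟨hbi _ _ h, hTmem b hb⟩)
    (by
      rintro a b ⟨-, hb, -⟩
      exact hTmem b (by exact_mod_cast hb)) h1
  have hkdir : ∀ t, ¬ (G.marg (T : Set (Fin d))).dir k t := by
    intro t ht
    rcases hTmem t (by exact_mod_cast ht.2.1) with rfl | rfl | htL
    · have := h1 ⟨t, [(EKind.bwd, k)]⟩ ⟨⟨by simp, ht, trivial⟩, rfl, by simp [MWalk.last]⟩
        (by simpa [MWalk.IsPath, MWalk.verts] using hjk) (by
          rintro ⟨i, v, hi, -⟩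
          simp at hi)
      simp at this
    · obtain ⟨-, -, w, hw, hr, -⟩ := ht
      exact hacy t ⟨w, hw, hr⟩
    · exact h2 ⟨t, by exact_mod_cast htL, ⟨k, [(EKind.fwd, t)]⟩,
        ⟨⟨by simp, ht, trivial⟩, rfl, by simp [MWalk.last]⟩, by simp [MWalk.IsRightDirected]⟩
  have hBT : ∀ s ∈ T, ∀ t, B s t = (β * P) s t := by
    intro s hs t; simp [hB, hs]
  have hfinal := aux_linalg A St M hMpd hASA ⟨j, hjT⟩ ⟨k, hkT⟩
    {c | K.Reachable c k} (SimpleGraph.Reachable.refl _) ((β * P) j k) ?_ ?_ ?_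
  · rw [hfinal, ← (aux_sum G wf T β P Λ hβc hP k hkT j).2]
    have himg : {w : MWalk (Fin d) | MWalk.IsWalkFrom G w j k ∧ w.IsRightDirected ∧
        ∀ v ∈ w.interior, v ∉ (T : Set (Fin d))} = (fun l => MWalk.mk j l) '' auxS G T k j := by
      ext ⟨x, l⟩
      constructor
      · rintro ⟨⟨⟨g1, g2⟩, rfl, g3⟩, h4, h5⟩
        exact ⟨l, ⟨g1, g2, g3, h4, fun y hy => by exact_mod_cast h5 y hy⟩, rfl⟩
      · rintro ⟨m, ⟨g1, g2, g3, h4, h5⟩, h⟩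
        simp only [MWalk.mk.injEq] at h
        obtain ⟨rfl, rfl⟩ := h
        exact ⟨⟨⟨g1, g2⟩, rfl, g3⟩, h4, fun y hy => by exact_mod_cast h5 y hy⟩
    rw [himg, finsum_mem_image]
    · rfl
    · intro a _ b _ h
      simpa using h
  · intro a c ha hc
    by_contra hne
    apply ha
    have hac : (a : Fin d) ≠ c := by
      rintro h
      exact ha (by simpa [h] using hc)
    have : K.Adj a c := ⟨hac, a.2, c.2, hne⟩
    exact this.reachable.trans hc
  · intro a
    have : B k a = 0 := by
      rw [hBT k hkT]
      by_contra h
      exact hkdir a (hdirw k hkT a a.2 h)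
    rw [hA]
    simp only [Matrix.sub_apply, Matrix.submatrix_apply, this, Matrix.one_apply, sub_zero]
    simp [eq_comm]
  · intro a ha
    have haj : (⟨j, hjT⟩ : {x // x ∈ T}) ≠ a := by
      rintro rfl
      exact hc1 ha
    rw [hA]
    simp only [Matrix.sub_apply, Matrix.submatrix_apply, Matrix.one_apply, if_neg haj, zero_sub]
    rw [hBT j hjT]
    by_cases hak : a = ⟨k, hkT⟩
    · simp [hak]
    · rw [if_neg hak, neg_eq_zero]
      by_contra h
      exact hc2 a ha (fun h => hak (Subtype.ext h)) (hdirw j hjT a a.2 h)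
end
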